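/- arXiv:2412.15746 — 6 statements merged into one kernel-verified Lean document; each statement's English description precedes it below -/
import Mathlib

section
/- Let κ be a Volterra kernel of continuous type, let Z : [0,∞) → ℝ be a continuous function with Z(0) = 0, and let g : [0,∞) × ℝ → [0,∞) be a non-negative continuous function that is non-decreasing in its second argument and such that for every n ∈ ℕ and T > 0 there is a constant L(n,T) > 0 with sup_{t∈[0,T]} |g(t,x) − g(t,y)| ≤ L(n,T)·|x − y| for all x, y ∈ ℝ with |x| ≤ n and |y| ≤ n. Then there exists a unique continuous function X : [0,∞) → ℝ satisfying X(t) = Z(t) − ∫_0^t κ(t,s)·g(s, X(s)) ds for all t ≥ 0. -/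
open MeasureTheory Filter Set
open scoped ENNReal

/-- A Volterra kernel of continuous type: a measurable non-negative function on
`Δ = {(t,s) : 0 ≤ s ≤ t}`, extended by `0` off `Δ`, such that `κ(t,·) ∈ L¹([0,∞))`
for every `t ≥ 0` and the map `t ↦ κ(t,·)` from `[0,∞)` to `L¹([0,∞))` is continuous
(continuity being expressed via convergence of the `L¹` distance). -/
def IsVolterraKernelOfContinuousType (κ : ℝ → ℝ → ℝ) : Prop :=
  Measurable (Function.uncurry κ) ∧
  (∀ t s, 0 ≤ κ t s) ∧
  (∀ t s, t < s → κ t s = 0) ∧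
  (∀ t s, s < 0 → κ t s = 0) ∧
  (∀ t, 0 ≤ t → IntegrableOn (κ t) (Ici 0)) ∧
  (∀ t, 0 ≤ t →
    Tendsto (fun u => ∫ s in Ici (0 : ℝ), |κ u s - κ t s|)
      (nhdsWithin t (Ici 0)) (nhds 0))

namespace IsVolterraKernelOfContinuousType

variable {κ : ℝ → ℝ → ℝ}

lemma integrableOn_mul (hκ : IsVolterraKernelOfContinuousType κ) {t M : ℝ} (ht : 0 ≤ t)
    {f : ℝ → ℝ} (hf : Continuous f) (hM : ∀ s, |f s| ≤ M) :
    IntegrableOn (fun s => κ t s * f s) (Ici 0) :=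
  (hκ.2.2.2.2.1 t ht).mul_bdd hf.aestronglyMeasurable (Eventually.of_forall hM)

lemma intervalIntegrable_mul (hκ : IsVolterraKernelOfContinuousType κ) {t : ℝ} (ht : 0 ≤ t)
    {f : ℝ → ℝ} (hf : ContinuousOn f (Icc 0 t)) :
    IntervalIntegrable (fun s => κ t s * f s) volume 0 t := by
  have h : IntervalIntegrable (κ t) volume 0 t := by
    rw [intervalIntegrable_iff_integrableOn_Ioc_of_le ht]
    exact (hκ.2.2.2.2.1 t ht).mono_set fun s hs => hs.1.le
  exact h.mul_continuousOn (by rwa [uIcc_of_le ht])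

lemma setIntegral_Ici_eq (hκ : IsVolterraKernelOfContinuousType κ) {t : ℝ} (ht : 0 ≤ t)
    (f : ℝ → ℝ) :
    ∫ s in Ici (0 : ℝ), κ t s * f s = ∫ s in (0 : ℝ)..t, κ t s * f s := by
  rw [intervalIntegral.integral_of_le ht, integral_Ici_eq_integral_Ioi]
  refine setIntegral_eq_of_subset_of_forall_sdiff_eq_zero measurableSet_Ioi
    (fun s hs => hs.1) fun s hs => ?_
  have hts : t < s := by
    by_contra! h
    exact hs.2 ⟨hs.1, h⟩
  rw [hκ.2.2.1 t s hts, zero_mul]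

lemma continuousOn_integral_mul (hκ : IsVolterraKernelOfContinuousType κ) {M : ℝ}
    {f : ℝ → ℝ → ℝ} (hf : Continuous (Function.uncurry f)) (hM : ∀ t s, |f t s| ≤ M) :
    ContinuousOn (fun t => ∫ s in Ici (0 : ℝ), κ t s * f t s) (Ici 0) := by
  intro t ht
  have hfs : ∀ u, Continuous (f u) := fun u => by fun_prop
  have hft : ∀ s, Continuous fun u => f u s := fun s => by fun_prop
  have hlim : Tendsto (fun u => ∫ s in Ici (0 : ℝ), κ t s * f u s) (nhdsWithin t (Ici 0))
      (nhds (∫ s in Ici (0 : ℝ), κ t s * f t s)) := by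
    refine tendsto_integral_filter_of_dominated_convergence (fun s => κ t s * M)
      (Eventually.of_forall fun u =>
        (hκ.integrableOn_mul ht (hfs u) (hM u)).aestronglyMeasurable)
      (Eventually.of_forall fun u => Eventually.of_forall fun s => ?_)
      ((hκ.2.2.2.2.1 t ht).mul_const M)
      (Eventually.of_forall fun s => ?_)
    · rw [norm_mul, Real.norm_of_nonneg (hκ.2.1 t s)]
      exact mul_le_mul_of_nonneg_left (hM u s) (hκ.2.1 t s)
    · exact (((hft s).tendsto t).mono_left nhdsWithin_le_nhds).const_mul _
  have hzero : Tendsto (fun u => ∫ s in Ici (0 : ℝ), (κ u s - κ t s) * f u s)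
      (nhdsWithin t (Ici 0)) (nhds 0) := by
    refine squeeze_zero_norm' ?_
      (by simpa using (hκ.2.2.2.2.2 t ht).mul_const M)
    filter_upwards [self_mem_nhdsWithin] with u hu
    rw [← integral_mul_const]
    refine norm_integral_le_of_norm_le
      (((hκ.2.2.2.2.1 u hu).sub (hκ.2.2.2.2.1 t ht)).abs.mul_const M)
      (Eventually.of_forall fun s => ?_)
    rw [norm_mul]
    exact mul_le_mul_of_nonneg_left (hM u s) (abs_nonneg _)
  have hsum := hzero.add hlim
  rw [zero_add] at hsum
  refine hsum.congr' ?_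
  filter_upwards [self_mem_nhdsWithin] with u hu
  have h1 := hκ.integrableOn_mul hu (hfs u) (hM u)
  have h2 := hκ.integrableOn_mul ht (hfs u) (hM u)
  simp_rw [sub_mul]
  rw [integral_sub h1 h2, sub_add_cancel]

lemma continuousOn_intervalIntegral_mul (hκ : IsVolterraKernelOfContinuousType κ) {M : ℝ}
    {f : ℝ → ℝ} (hf : Continuous f) (hM : ∀ s, |f s| ≤ M) :
    ContinuousOn (fun t => ∫ s in (0 : ℝ)..t, κ t s * f s) (Ici 0) :=
  (hκ.continuousOn_integral_mul (f := fun _ s => f s) (by fun_prop)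
    fun _ => hM).congr fun _ ht => (hκ.setIntegral_Ici_eq ht f).symm

lemma abs_exp_neg_mul_abs_le {l : ℝ} (hl : 0 ≤ l) (t s : ℝ) :
    |Real.exp (-(l * |t - s|))| ≤ 1 := by
  rw [Real.abs_exp, Real.exp_le_one_iff]
  have := mul_nonneg hl (abs_nonneg (t - s))
  linarith

/-- The exponentially weighted mass of the kernel is small, uniformly on compact intervals. -/
lemma exists_integral_exp_le (hκ : IsVolterraKernelOfContinuousType κ) (T : ℝ) {ε : ℝ}
    (hε : 0 < ε) :
    ∃ l, 0 ≤ l ∧ ∀ t ∈ Icc 0 T,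
      ∫ s in Ici (0 : ℝ), κ t s * Real.exp (-(l * |t - s|)) ≤ ε := by
  suffices h : ∃ l, 0 ≤ l ∧ ∀ l' ≥ l, ∀ t ∈ Icc 0 T, 0 ≤ t →
      ∫ s in Ici (0 : ℝ), κ t s * Real.exp (-(l' * |t - s|)) ≤ ε by
    obtain ⟨l, hl, h⟩ := h
    exact ⟨l, hl, fun t ht => h l le_rfl t ht ht.1⟩
  refine isCompact_Icc.induction_on
    (p := fun S => ∃ l, 0 ≤ l ∧ ∀ l' ≥ l, ∀ t ∈ S, 0 ≤ t →
      ∫ s in Ici (0 : ℝ), κ t s * Real.exp (-(l' * |t - s|)) ≤ ε)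
    ⟨0, le_rfl, by simp⟩ ?_ ?_ ?_
  · rintro S S' hS ⟨l, hl, h⟩
    exact ⟨l, hl, fun l' hl' t ht => h l' hl' t (hS ht)⟩
  · rintro S S' ⟨l, hl, h⟩ ⟨m, hm, h'⟩
    refine ⟨max l m, le_max_of_le_left hl, fun l' hl' t ht => ?_⟩
    rcases ht with ht | ht
    · exact h l' ((le_max_left _ _).trans hl') t ht
    · exact h' l' ((le_max_right _ _).trans hl') t ht
  intro t ht
  have hexp : ∀ l t : ℝ, Continuous fun s => Real.exp (-(l * |t - s|)) := by
    intro l t; fun_prop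
  have hlim : Tendsto (fun l => ∫ s in Ici (0 : ℝ), κ t s * Real.exp (-(l * |t - s|))) atTop
      (nhds (∫ _ in Ici (0 : ℝ), (0 : ℝ))) := by
    refine tendsto_integral_filter_of_dominated_convergence (κ t) ?_ ?_
      (hκ.2.2.2.2.1 t ht.1) ?_
    · filter_upwards [eventually_ge_atTop 0] with l hl
      exact (hκ.integrableOn_mul ht.1 (hexp l t)
        (abs_exp_neg_mul_abs_le hl t)).aestronglyMeasurable
    · filter_upwards [eventually_ge_atTop 0] with l hl
      refine Eventually.of_forall fun s => ?_
      rw [norm_mul, Real.norm_of_nonneg (hκ.2.1 t s)]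
      exact mul_le_of_le_one_right (hκ.2.1 t s) (abs_exp_neg_mul_abs_le hl t s)
    · refine ae_restrict_of_ae ?_
      filter_upwards [Measure.ae_ne volume t] with s hs
      have hpos : 0 < |t - s| := abs_pos.2 (sub_ne_zero.2 hs.symm)
      have := (Real.tendsto_exp_neg_atTop_nhds_zero.comp
        (tendsto_id.atTop_mul_const hpos)).const_mul (κ t s)
      simpa using this
  rw [integral_zero] at hlim
  obtain ⟨l, hlε, hl⟩ := ((hlim.eventually (gt_mem_nhds hε)).and (eventually_ge_atTop 0)).exists
  have hcont := hκ.continuousOn_integral_mul (f := fun t s => Real.exp (-(l * |t - s|)))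
    (by fun_prop) (abs_exp_neg_mul_abs_le hl) t ht.1
  have hev := hcont.eventually (gt_mem_nhds hlε)
  refine ⟨_, mem_nhdsWithin_of_mem_nhds (eventually_nhdsWithin_iff.1 hev), l, hl, ?_⟩
  intro l' hl' u hu hu0
  refine le_trans (setIntegral_mono
    (hκ.integrableOn_mul hu0 (hexp l' u) (abs_exp_neg_mul_abs_le (hl.trans hl') u))
    (hκ.integrableOn_mul hu0 (hexp l u) (abs_exp_neg_mul_abs_le hl u)) fun s => ?_)
    (hu hu0).le
  have := hκ.2.1 u s
  dsimp only
  gcongr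

lemma abs_intervalIntegral_mul_le (hκ : IsVolterraKernelOfContinuousType κ) {l ε t D : ℝ}
    (hl : 0 ≤ l) (ht : 0 ≤ t)
    (hε : ∫ s in Ici (0 : ℝ), κ t s * Real.exp (-(l * |t - s|)) ≤ ε) (hD : 0 ≤ D) {f : ℝ → ℝ}
    (hf : ∀ s ∈ Icc 0 t, |f s| ≤ D * Real.exp (l * s)) :
    |∫ s in (0 : ℝ)..t, κ t s * f s| ≤ D * ε * Real.exp (l * t) := by
  rw [← hκ.setIntegral_Ici_eq ht]
  have hint := hκ.integrableOn_mul (f := fun s => Real.exp (-(l * |t - s|))) ht (by fun_prop)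
    (abs_exp_neg_mul_abs_le hl t)
  calc |∫ s in Ici (0 : ℝ), κ t s * f s|
      ≤ ∫ s in Ici (0 : ℝ), (D * Real.exp (l * t)) * (κ t s * Real.exp (-(l * |t - s|))) := by
        rw [← Real.norm_eq_abs]
        refine norm_integral_le_of_norm_le (hint.const_mul _) ?_
        filter_upwards [ae_restrict_mem measurableSet_Ici] with s hs
        rw [norm_mul, Real.norm_of_nonneg (hκ.2.1 t s)]
        rcases lt_or_ge t s with hts | hts
        · simp [hκ.2.2.1 t s hts]
        · have he : Real.exp (l * s) = Real.exp (l * t) * Real.exp (-(l * |t - s|)) := by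
            rw [← Real.exp_add, abs_of_nonneg (sub_nonneg.2 hts)]
            ring_nf
          have h := mul_le_mul_of_nonneg_left (hf s ⟨hs, hts⟩) (hκ.2.1 t s)
          rw [he] at h
          rw [Real.norm_eq_abs]
          linarith
    _ = (D * Real.exp (l * t)) * ∫ s in Ici (0 : ℝ), κ t s * Real.exp (-(l * |t - s|)) :=
        integral_const_mul _ _
    _ ≤ (D * Real.exp (l * t)) * ε := by gcongr
    _ = D * ε * Real.exp (l * t) := by ring

lemma eqOn_of_solution (hκ : IsVolterraKernelOfContinuousType κ) {Z : ℝ → ℝ} {g : ℝ → ℝ → ℝ}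
    (hg_cont : ContinuousOn (Function.uncurry g) (Ici 0 ×ˢ (univ : Set ℝ)))
    (hg_lip : ∀ (n : ℕ) (T : ℝ), 0 < T → ∃ L > (0 : ℝ),
      ∀ t ∈ Icc (0 : ℝ) T, ∀ x y : ℝ, |x| ≤ (n : ℝ) → |y| ≤ (n : ℝ) →
        |g t x - g t y| ≤ L * |x - y|) {T : ℝ} (hT : 0 < T) {X Y : ℝ → ℝ}
    (hX : ContinuousOn X (Icc 0 T)) (hY : ContinuousOn Y (Icc 0 T))
    (hXe : ∀ t ∈ Icc 0 T, X t = Z t - ∫ s in (0 : ℝ)..t, κ t s * g s (X s))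
    (hYe : ∀ t ∈ Icc 0 T, Y t = Z t - ∫ s in (0 : ℝ)..t, κ t s * g s (Y s)) :
    EqOn X Y (Icc 0 T) := by
  obtain ⟨A, hA⟩ := isCompact_Icc.exists_bound_of_continuousOn hX
  obtain ⟨B, hB⟩ := isCompact_Icc.exists_bound_of_continuousOn hY
  obtain ⟨n, hn⟩ := exists_nat_ge (max A B)
  obtain ⟨L, hL, hlip⟩ := hg_lip n T hT
  obtain ⟨l, hl, hle⟩ := hκ.exists_integral_exp_le T (ε := 1 / (2 * L)) (by positivity)
  obtain ⟨r, hr, hmax⟩ := isCompact_Icc.exists_isMaxOn (nonempty_Icc.2 hT.le)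
    (f := fun t => Real.exp (-(l * t)) * |X t - Y t|) (by fun_prop)
  set D := Real.exp (-(l * r)) * |X r - Y r| with hD
  have hD0 : 0 ≤ D := by positivity
  have hbound : ∀ t ∈ Icc 0 T, |X t - Y t| ≤ D * Real.exp (l * t) := fun t ht => by
    have h : Real.exp (-(l * t)) * |X t - Y t| ≤ D := hmax ht
    rwa [Real.exp_neg, inv_mul_le_iff₀ (Real.exp_pos _), mul_comm] at h
  have hsub : Icc 0 r ⊆ Icc 0 T := Icc_subset_Icc_right hr.2
  have hg_comp : ∀ W : ℝ → ℝ, ContinuousOn W (Icc 0 T) →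
      ContinuousOn (fun s => g s (W s)) (Icc 0 r) := fun W hW =>
    hg_cont.comp (continuousOn_id.prodMk (hW.mono hsub)) fun s hs => ⟨hs.1, mem_univ _⟩
  have hdiff : X r - Y r = -∫ s in (0 : ℝ)..r, κ r s * (g s (X s) - g s (Y s)) := by
    simp_rw [mul_sub]
    rw [intervalIntegral.integral_sub (hκ.intervalIntegrable_mul hr.1 (hg_comp X hX))
      (hκ.intervalIntegrable_mul hr.1 (hg_comp Y hY))]
    linarith [hXe r hr, hYe r hr]
  have hest := hκ.abs_intervalIntegral_mul_le hl hr.1 (hle r hr) (D := L * D) (by positivity)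
    (f := fun s => g s (X s) - g s (Y s)) fun s hs => by
      have hs' := hsub hs
      refine (hlip s hs' _ _ ((hA s hs').trans ((le_max_left _ _).trans hn))
        ((hB s hs').trans ((le_max_right _ _).trans hn))).trans ?_
      rw [mul_assoc]
      exact mul_le_mul_of_nonneg_left (hbound s hs') hL.le
  rw [← abs_neg, ← hdiff] at hest
  have hhalf : L * D * (1 / (2 * L)) = D / 2 := by field_simp
  rw [hhalf] at hest
  have hDle : D ≤ D / 2 := by
    rw [hD, Real.exp_neg, inv_mul_le_iff₀ (Real.exp_pos _), ← Real.exp_neg, ← hD, mul_comm]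
    exact hest
  have hDz : D = 0 := by linarith
  intro t ht
  have h := hbound t ht
  rw [hDz, zero_mul] at h
  exact sub_eq_zero.1 (abs_nonpos_iff.1 h)

/-- Existence on a compact interval for bounded, globally Lipschitz nonlinearities. -/
lemma exists_solution_of_lipschitz (hκ : IsVolterraKernelOfContinuousType κ) {Z : ℝ → ℝ}
    {h : ℝ → ℝ → ℝ} {T M L : ℝ} (hT : 0 < T) (hZ : ContinuousOn Z (Icc 0 T))
    (hh : Continuous (Function.uncurry h)) (hM : ∀ t x, |h t x| ≤ M) (hL : 0 < L)
    (hlip : ∀ t x y, |h t x - h t y| ≤ L * |x - y|) :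
    ∃ X : ℝ → ℝ, Continuous X ∧
      ∀ t ∈ Icc 0 T, X t = Z t - ∫ s in (0 : ℝ)..t, κ t s * h s (X s) := by
  obtain ⟨l, hl, hle⟩ := hκ.exists_integral_exp_le T (ε := 1 / (2 * L)) (by positivity)
  let E : C(Icc 0 T, ℝ) → ℝ → ℝ := fun Y s => Real.exp (l * s) * Y (projIcc 0 T hT.le s)
  have hE : ∀ Y, Continuous (E Y) := fun Y =>
    (by fun_prop : Continuous fun s => Real.exp (l * s)).mul
      (Y.continuous.comp continuous_projIcc)
  have hhE : ∀ Y, Continuous fun s => h s (E Y s) := fun Y =>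
    hh.comp (continuous_id.prodMk (hE Y))
  let Φ : C(Icc 0 T, ℝ) → C(Icc 0 T, ℝ) := fun Y =>
    { toFun := fun t => Real.exp (-(l * t)) *
        (Z t - ∫ s in (0 : ℝ)..t, κ t s * h s (E Y s))
      continuous_toFun := by
        refine Continuous.mul (by fun_prop) (Continuous.sub ?_ ?_)
        · exact continuousOn_iff_continuous_domRestrict.1 hZ
        · exact continuousOn_iff_continuous_domRestrict.1
            ((hκ.continuousOn_intervalIntegral_mul (hhE Y) fun s => hM s _).mono
              Icc_subset_Ici_self) }
  have hΦ : ContractingWith (1 / 2) Φ := by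
    refine ⟨by norm_num, LipschitzWith.of_dist_le_mul fun Y W => ?_⟩
    rw [ContinuousMap.dist_le (by positivity)]
    intro t
    have hdiff : Φ Y t - Φ W t = -(Real.exp (-(l * t)) *
        ∫ s in (0 : ℝ)..t, κ t s * (h s (E Y s) - h s (E W s))) := by
      simp_rw [mul_sub]
      rw [intervalIntegral.integral_sub
        (hκ.intervalIntegrable_mul t.2.1 (hhE Y).continuousOn)
        (hκ.intervalIntegrable_mul t.2.1 (hhE W).continuousOn)]
      simp only [Φ, ContinuousMap.coe_mk]
      ring
    have hest := hκ.abs_intervalIntegral_mul_le hl t.2.1 (hle t t.2) (D := L * dist Y W)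
      (by positivity) (f := fun s => h s (E Y s) - h s (E W s)) fun s _ => by
        refine (hlip s _ _).trans ?_
        rw [mul_assoc]
        refine mul_le_mul_of_nonneg_left ?_ hL.le
        simp only [E]
        rw [← mul_sub, abs_mul, Real.abs_exp, mul_comm]
        exact mul_le_mul_of_nonneg_right ((Real.dist_eq _ _).symm.trans_le (ContinuousMap.dist_apply_le_dist _))
          (Real.exp_pos _).le
    have hhalf : L * dist Y W * (1 / (2 * L)) = dist Y W / 2 := by field_simp
    rw [hhalf] at hest
    rw [Real.dist_eq, hdiff, abs_neg, abs_mul, Real.abs_exp, Real.exp_neg,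
      inv_mul_le_iff₀ (Real.exp_pos _)]
    refine hest.trans (le_of_eq ?_)
    push_cast
    ring
  obtain ⟨Y, hY, -⟩ := hΦ.exists_fixedPoint 0 (edist_ne_top _ _)
  refine ⟨E Y, hE Y, fun t ht => ?_⟩
  have hfix : Φ Y ⟨t, ht⟩ = Y ⟨t, ht⟩ := DFunLike.congr_fun hY.eq _
  have hEt : E Y t = Real.exp (l * t) * Y ⟨t, ht⟩ := by
    simp only [E, projIcc_of_mem hT.le ht]
  rw [hEt, ← hfix]
  simp only [Φ, ContinuousMap.coe_mk]
  rw [← mul_assoc, ← Real.exp_add, add_neg_cancel, Real.exp_zero, one_mul]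

lemma exists_solution_Icc (hκ : IsVolterraKernelOfContinuousType κ) {Z : ℝ → ℝ}
    (hZ : ContinuousOn Z (Ici 0)) {g : ℝ → ℝ → ℝ}
    (hg_cont : ContinuousOn (Function.uncurry g) (Ici 0 ×ˢ (univ : Set ℝ)))
    (hg_nonneg : ∀ t x, 0 ≤ t → 0 ≤ g t x)
    (hg_mono : ∀ t, 0 ≤ t → Monotone (g t))
    (hg_lip : ∀ (n : ℕ) (T : ℝ), 0 < T → ∃ L > (0 : ℝ),
      ∀ t ∈ Icc (0 : ℝ) T, ∀ x y : ℝ, |x| ≤ (n : ℝ) → |y| ≤ (n : ℝ) →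
        |g t x - g t y| ≤ L * |x - y|) {T : ℝ} (hT : 0 < T) :
    ∃ X : ℝ → ℝ, Continuous X ∧
      ∀ t ∈ Icc 0 T, X t = Z t - ∫ s in (0 : ℝ)..t, κ t s * g s (X s) := by
  have hZT : ContinuousOn Z (Icc 0 T) := hZ.mono Icc_subset_Ici_self
  obtain ⟨B, hB⟩ := isCompact_Icc.exists_bound_of_continuousOn hZT
  have hgZ : ContinuousOn (fun s => g s (Z s)) (Icc 0 T) :=
    hg_cont.comp (continuousOn_id.prodMk hZT) fun s hs => ⟨hs.1, mem_univ _⟩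
  obtain ⟨M, hM⟩ := isCompact_Icc.exists_bound_of_continuousOn hgZ
  obtain ⟨K, hK⟩ := isCompact_Icc.exists_bound_of_continuousOn
    ((hκ.continuousOn_intervalIntegral_mul (f := fun _ => 1) (M := 1) continuous_const
      (by simp)).mono (Icc_subset_Ici_self : Icc 0 T ⊆ Ici 0))
  have h0 : (0 : ℝ) ∈ Icc 0 T := ⟨le_rfl, hT.le⟩
  have hB0 : 0 ≤ B := (norm_nonneg _).trans (hB 0 h0)
  have hM0 : 0 ≤ M := (norm_nonneg _).trans (hM 0 h0)
  have hK0 : 0 ≤ K := (norm_nonneg _).trans (hK 0 h0)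
  obtain ⟨n, hn⟩ := exists_nat_ge (B + M * K)
  have hMK : 0 ≤ M * K := mul_nonneg hM0 hK0
  have hnn : -(n : ℝ) ≤ n := by linarith
  obtain ⟨L, hL, hlip⟩ := hg_lip n T hT
  let c : ℝ → ℝ := fun x => projIcc (-(n : ℝ)) n hnn x
  let τ : ℝ → ℝ := fun t => projIcc 0 T hT.le t
  have hc : Continuous c := continuous_subtype_val.comp continuous_projIcc
  have hτ : Continuous τ := continuous_subtype_val.comp continuous_projIcc
  have hcmem : ∀ x, c x ∈ Icc (-(n : ℝ)) n := fun x => (projIcc _ _ hnn x).2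
  have hτmem : ∀ t, τ t ∈ Icc 0 T := fun t => (projIcc _ _ hT.le t).2
  have hcabs : ∀ x, |c x| ≤ n := fun x => abs_le.2 (hcmem x)
  have hc_of : ∀ x : ℝ, |x| ≤ n → c x = x := fun x hx => by
    simp only [c, projIcc_of_mem hnn (abs_le.1 hx)]
  have hτ_of : ∀ t ∈ Icc 0 T, τ t = t := fun t ht => by
    simp only [τ, projIcc_of_mem hT.le ht]
  have hcmono : Monotone c := fun x y hxy => monotone_projIcc hnn hxy
  have hclip : ∀ x y, |c x - c y| ≤ |x - y| := fun x y => by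
    exact abs_projIcc_sub_projIcc hnn
  let h : ℝ → ℝ → ℝ := fun t x => g (τ t) (c x)
  have hh : Continuous (Function.uncurry h) :=
    hg_cont.comp_continuous ((hτ.comp continuous_fst).prodMk (hc.comp continuous_snd))
      fun p => ⟨(hτmem p.1).1, mem_univ _⟩
  obtain ⟨A, hA⟩ := (isCompact_Icc (a := (0 : ℝ)) (b := T)).prod
    (isCompact_Icc (a := -(n : ℝ)) (b := n)) |>.exists_bound_of_continuousOn
    (hg_cont.mono (prod_mono Icc_subset_Ici_self (subset_univ _)))
  obtain ⟨X, hX, hXe⟩ := hκ.exists_solution_of_lipschitz hT hZT hh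
    (fun t x => hA (τ t, c x) ⟨hτmem t, hcmem x⟩) hL fun t x y =>
      (hlip _ (hτmem t) _ _ (hcabs x) (hcabs y)).trans
        (mul_le_mul_of_nonneg_left (hclip x y) hL.le)
  have hh0 : ∀ t x, 0 ≤ h t x := fun t x => hg_nonneg _ _ (hτmem t).1
  have hXZ : ∀ t ∈ Icc 0 T, X t ≤ Z t := fun t ht => by
    have : 0 ≤ ∫ s in (0 : ℝ)..t, κ t s * h s (X s) :=
      intervalIntegral.integral_nonneg ht.1 fun s _ => mul_nonneg (hκ.2.1 t s) (hh0 _ _)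
    linarith [hXe t ht]
  have hXn : ∀ t ∈ Icc 0 T, |X t| ≤ n := fun t ht => by
    have hle : ∫ s in (0 : ℝ)..t, κ t s * h s (X s) ≤ M * K := by
      calc ∫ s in (0 : ℝ)..t, κ t s * h s (X s)
          ≤ ∫ s in (0 : ℝ)..t, M * (κ t s * 1) := by
            refine intervalIntegral.integral_mono_on ht.1
              (hκ.intervalIntegrable_mul ht.1
                (hh.comp (continuous_id.prodMk hX)).continuousOn)
              ((hκ.intervalIntegrable_mul ht.1 continuousOn_const).const_mul M)
              fun s hs => ?_
            have hs' : s ∈ Icc 0 T := ⟨hs.1, hs.2.trans ht.2⟩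
            have hZs : |Z s| ≤ n := (hB s hs').trans (by linarith)
            have hgs : h s (X s) ≤ M := by
              calc h s (X s) ≤ g (τ s) (c (Z s)) :=
                    hg_mono _ (hτmem s).1 (hcmono (hXZ s hs'))
                _ = g s (Z s) := by rw [hτ_of s hs', hc_of _ hZs]
                _ ≤ M := (le_abs_self _).trans (hM s hs')
            rw [mul_one, mul_comm M]
            exact mul_le_mul_of_nonneg_left hgs (hκ.2.1 t s)
        _ = M * ∫ s in (0 : ℝ)..t, κ t s * 1 := intervalIntegral.integral_const_mul _ _
        _ ≤ M * K := mul_le_mul_of_nonneg_left ((le_abs_self _).trans (hK t ht)) hM0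
    have hZt := abs_le.1 (hB t ht)
    rw [abs_le]
    constructor <;> linarith [hXe t ht, hXZ t ht]
  refine ⟨X, hX, fun t ht => ?_⟩
  rw [hXe t ht]
  congr 1
  refine intervalIntegral.integral_congr fun s hs => ?_
  rw [uIcc_of_le ht.1] at hs
  have hs' : s ∈ Icc 0 T := ⟨hs.1, hs.2.trans ht.2⟩
  simp only [h, hτ_of s hs', hc_of _ (hXn s hs')]

end IsVolterraKernelOfContinuousType

/-- **Existence and uniqueness for the deterministic Volterra integral equation**
`X(t) = Z(t) − ∫_0^t κ(t,s) g(s, X(s)) ds` on `[0,∞)`, where `κ` is a Volterra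
kernel of continuous type, `Z` is continuous with `Z(0) = 0`, and `g ≥ 0` is
continuous on `[0,∞) × ℝ`, non-decreasing in the second argument, and locally
Lipschitz in the second argument, uniformly in `t` on compact time intervals. -/
theorem volterra_integral_equation_exists_unique
    (κ : ℝ → ℝ → ℝ) (hκ : IsVolterraKernelOfContinuousType κ)
    (Z : ℝ → ℝ) (hZ : ContinuousOn Z (Ici 0)) (hZ0 : Z 0 = 0)
    (g : ℝ → ℝ → ℝ)
    (hg_cont : ContinuousOn (Function.uncurry g) (Ici 0 ×ˢ (univ : Set ℝ)))
    (hg_nonneg : ∀ t x, 0 ≤ t → 0 ≤ g t x)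
    (hg_mono : ∀ t, 0 ≤ t → Monotone (g t))
    (hg_lip : ∀ (n : ℕ) (T : ℝ), 0 < T → ∃ L > (0 : ℝ),
      ∀ t ∈ Icc (0 : ℝ) T, ∀ x y : ℝ, |x| ≤ (n : ℝ) → |y| ≤ (n : ℝ) →
        |g t x - g t y| ≤ L * |x - y|) :
    ∃ X : ℝ → ℝ, ContinuousOn X (Ici 0) ∧
      (∀ t, 0 ≤ t → X t = Z t - ∫ s in (0 : ℝ)..t, κ t s * g s (X s)) ∧
      ∀ X' : ℝ → ℝ, ContinuousOn X' (Ici 0) →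
        (∀ t, 0 ≤ t → X' t = Z t - ∫ s in (0 : ℝ)..t, κ t s * g s (X' s)) →
        ∀ t, 0 ≤ t → X' t = X t := by
  have hpos : ∀ n : ℕ, (0 : ℝ) < (n : ℝ) + 1 := fun n => by positivity
  choose W hW hWe using fun n : ℕ =>
    hκ.exists_solution_Icc hZ hg_cont hg_nonneg hg_mono hg_lip (hpos n)
  have hagree : ∀ n m : ℕ, n ≤ m → EqOn (W n) (W m) (Icc 0 ((n : ℝ) + 1)) := fun n m hnm => by
    have hnm' : (n : ℝ) + 1 ≤ (m : ℝ) + 1 := by exact_mod_cast Nat.succ_le_succ hnm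
    exact hκ.eqOn_of_solution hg_cont hg_lip (hpos n) (hW n).continuousOn (hW m).continuousOn
      (hWe n) fun t ht => hWe m t ⟨ht.1, ht.2.trans hnm'⟩
  let X : ℝ → ℝ := fun t => W ⌊t⌋₊ t
  have hXW : ∀ n : ℕ, EqOn X (W n) (Ico 0 ((n : ℝ) + 1)) := fun n t ht => by
    refine hagree ⌊t⌋₊ n ?_ ⟨ht.1, (Nat.lt_floor_add_one t).le⟩
    exact Nat.lt_succ_iff.1 ((Nat.floor_lt ht.1).2 (by exact_mod_cast ht.2))
  have hXe : ∀ t, 0 ≤ t → X t = Z t - ∫ s in (0 : ℝ)..t, κ t s * g s (X s) := fun t ht => by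
    have htn := Nat.lt_floor_add_one t
    rw [hXW ⌊t⌋₊ ⟨ht, htn⟩, hWe ⌊t⌋₊ t ⟨ht, htn.le⟩]
    congr 1
    refine intervalIntegral.integral_congr fun s hs => ?_
    rw [uIcc_of_le ht] at hs
    simp only [hXW ⌊t⌋₊ ⟨hs.1, hs.2.trans_lt htn⟩]
  have hXc : ContinuousOn X (Ici 0) := fun t ht => by
    have htn := Nat.lt_floor_add_one t
    refine (hW ⌊t⌋₊).continuousWithinAt.congr_of_eventuallyEq ?_ (hXW _ ⟨ht, htn⟩)
    filter_upwards [self_mem_nhdsWithin, mem_nhdsWithin_of_mem_nhds (Iio_mem_nhds htn)]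
      with u hu hun
    exact hXW _ ⟨hu, hun⟩
  refine ⟨X, hXc, hXe, fun Y hY hYe t ht => ?_⟩
  have ht1 : 0 < t + 1 := by linarith
  exact hκ.eqOn_of_solution hg_cont hg_lip ht1 (hY.mono Icc_subset_Ici_self)
    (hXc.mono Icc_subset_Ici_self) (fun s hs => hYe s hs.1) (fun s hs => hXe s hs.1)
    ⟨ht, by linarith⟩
end

section
/- Fix α > 1/2, η > 0, ρ ∈ [−1,0], and v₀ > 0, and let K_{α,η}(t,s) = η·√(2α−1)·(t−s)^{α−1} for 0 ≤ s < t (and 0 otherwise). Then for every continuous function Z : [0,∞) → ℝ with Z(0) = 0, there exists a unique continuous function Ỹ : [0,∞) → ℝ satisfying Ỹ(t) = Z(t) + ∫_0^t K_{α,η}(t,s)·ρ·√v₀·exp( Ỹ(s)/2 − (η²/4)·s^{2α−1} ) ds for all t ≥ 0. -/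
open MeasureTheory Filter Set
open scoped ENNReal

/-- The rough Bergomi kernel `K_{α,η}(t,s) = η √(2α−1) (t−s)^{α−1}` for
`0 ≤ s < t`, extended by `0` elsewhere. -/
noncomputable def roughBergomiKernel (α η : ℝ) : ℝ → ℝ → ℝ :=
  fun t s => if 0 ≤ s ∧ s < t then η * Real.sqrt (2 * α - 1) * (t - s) ^ (α - 1) else 0

/-- The Abel kernel `(t - s) ^ (α - 1)` is integrable against continuous functions. -/
theorem intervalIntegrable_sub_rpow_mul {α : ℝ} (hα : 0 < α) {f : ℝ → ℝ} (hf : Continuous f)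
    (t a b : ℝ) : IntervalIntegrable (fun s => (t - s) ^ (α - 1) * f s) volume a b := by
  refine IntervalIntegrable.mul_continuousOn ?_ hf.continuousOn
  have h := (intervalIntegral.intervalIntegrable_rpow' (r := α - 1) (a := t - a) (b := t - b)
    (by linarith)).comp_sub_left t
  simpa using h

/-- Rescaling an Abel integral to the unit interval. -/
theorem integral_sub_rpow_mul_eq {α : ℝ} (hα : 0 < α) (f : ℝ → ℝ) {t : ℝ} (ht : 0 ≤ t) :
    ∫ s in (0 : ℝ)..t, (t - s) ^ (α - 1) * f s =
      t ^ α * ∫ v in (0 : ℝ)..1, (1 - v) ^ (α - 1) * f (t * v) := by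
  rcases ht.eq_or_lt with rfl | ht'
  · simp [Real.zero_rpow hα.ne']
  have h := intervalIntegral.mul_integral_comp_mul_left (a := 0) (b := 1)
    (f := fun s => (t - s) ^ (α - 1) * f s) (c := t)
  simp only [mul_zero, mul_one] at h
  rw [← h, show t ^ α = t * t ^ (α - 1) by
    rw [Real.rpow_sub_one ht'.ne']; field_simp, mul_assoc,
    ← intervalIntegral.integral_const_mul (t ^ (α - 1))]
  congr 1
  refine intervalIntegral.integral_congr fun v hv => ?_
  rw [uIcc_of_le zero_le_one] at hv
  have : t - t * v = t * (1 - v) := by ring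
  simp only [this, Real.mul_rpow ht (sub_nonneg.2 hv.2), mul_assoc]

theorem continuousOn_integral_sub_rpow_mul {α : ℝ} (hα : 0 < α) {f : ℝ → ℝ} (hf : Continuous f) :
    ContinuousOn (fun t => ∫ s in (0 : ℝ)..t, (t - s) ^ (α - 1) * f s) (Ici 0) := by
  have hcont : Continuous fun t : ℝ =>
      ∫ v in (0 : ℝ)..1, (1 - v) ^ (α - 1) * f (t * v) := by
    refine continuous_iff_continuousAt.2 fun t₀ => ?_
    obtain ⟨M, hM⟩ := (isCompact_Icc (a := -(|t₀| + 1)) (b := |t₀| + 1)).exists_bound_of_continuousOn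
      hf.continuousOn
    refine intervalIntegral.continuousAt_of_dominated_interval
      (bound := fun v => (1 - v) ^ (α - 1) * M) ?_ ?_
      (intervalIntegrable_sub_rpow_mul hα continuous_const 1 0 1) ?_
    · exact .of_forall fun t => (intervalIntegrable_sub_rpow_mul hα
        (hf.comp (continuous_const_mul t)) 1 0 1).def'.aestronglyMeasurable
    · filter_upwards [Metric.ball_mem_nhds t₀ one_pos] with t ht
      refine .of_forall fun v hv => ?_
      rw [uIoc_of_le zero_le_one] at hv
      have hk : 0 ≤ (1 - v) ^ (α - 1) := Real.rpow_nonneg (sub_nonneg.2 hv.2) _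
      rw [norm_mul, Real.norm_of_nonneg hk]
      refine mul_le_mul_of_nonneg_left (hM _ (abs_le.1 ?_)) hk
      rw [Metric.mem_ball, Real.dist_eq] at ht
      have h1 : |t| ≤ |t₀| + 1 := by
        linarith [abs_sub_abs_le_abs_sub t t₀]
      rw [abs_mul, abs_of_pos hv.1]
      nlinarith [abs_nonneg t, hv.2]
    · exact .of_forall fun v _ => by fun_prop
  refine ContinuousOn.congr (f := fun t : ℝ => t ^ α *
    ∫ v in (0 : ℝ)..1, (1 - v) ^ (α - 1) * f (t * v)) ?_
    fun t ht => integral_sub_rpow_mul_eq hα f ht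
  exact ((Real.continuous_rpow_const hα.le).mul hcont).continuousOn

/-- An exponentially damped Abel kernel has mass at most `Γ(α) / lam ^ α`. -/
theorem integral_sub_rpow_mul_exp_le {α lam t : ℝ} (hα : 0 < α) (hlam : 0 < lam) (ht : 0 ≤ t) :
    ∫ s in (0 : ℝ)..t, (t - s) ^ (α - 1) * Real.exp (-(lam * (t - s))) ≤
      (1 / lam) ^ α * Real.Gamma α := by
  rw [intervalIntegral.integral_comp_sub_left
    (fun u => u ^ (α - 1) * Real.exp (-(lam * u))) t, sub_self, sub_zero,
    intervalIntegral.integral_of_le ht, ← Real.integral_rpow_mul_exp_neg_mul_Ioi hα hlam]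
  refine setIntegral_mono_set ?_ ?_ Ioc_subset_Ioi_self.eventuallyLE
  · have h := integrableOn_rpow_mul_exp_neg_mul_rpow (s := α - 1) (p := 1) (b := lam)
      (by linarith) one_pos hlam
    simpa using h
  · filter_upwards [self_mem_ae_restrict measurableSet_Ioi] with u hu
    exact mul_nonneg (Real.rpow_nonneg (le_of_lt hu) _) (Real.exp_pos _).le

theorem exists_pos_mul_one_div_rpow_mul_le_half {α L G : ℝ} (hα : 0 < α) (hL : 0 ≤ L) (hG : 0 ≤ G) :
    ∃ lam : ℝ, 0 < lam ∧ L * ((1 / lam) ^ α * G) ≤ 1 / 2 := by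
  have hB : 0 < 2 * (L * G) + 1 := by positivity
  refine ⟨(2 * (L * G) + 1) ^ α⁻¹, by positivity, ?_⟩
  rw [Real.div_rpow zero_le_one (by positivity), Real.one_rpow, ← Real.rpow_mul hB.le,
    inv_mul_cancel₀ hα.ne', Real.rpow_one]
  rw [show L * (1 / (2 * (L * G) + 1) * G) = L * G / (2 * (L * G) + 1) by ring, div_le_iff₀ hB]
  linarith

/-- Abel-Volterra equations with Lipschitz nonlinearity are uniquely solvable on `[0, T]`. -/
theorem abelVolterra_exists_unique_Icc {α L T : ℝ} (hα : 0 < α) (hL : 0 ≤ L) (hT : 0 ≤ T)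
    {Z : ℝ → ℝ} (hZ : Continuous Z) {F : ℝ → ℝ → ℝ} (hF : Continuous (Function.uncurry F))
    (hLip : ∀ s ∈ Icc 0 T, ∀ x y, |F s x - F s y| ≤ L * |x - y|) :
    ∃ Y : ℝ → ℝ, ContinuousOn Y (Icc 0 T) ∧
      (∀ t ∈ Icc 0 T, Y t = Z t + ∫ s in (0 : ℝ)..t, (t - s) ^ (α - 1) * F s (Y s)) ∧
      ∀ Y' : ℝ → ℝ, ContinuousOn Y' (Icc 0 T) →
        (∀ t ∈ Icc 0 T, Y' t = Z t + ∫ s in (0 : ℝ)..t, (t - s) ^ (α - 1) * F s (Y' s)) →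
        EqOn Y' Y (Icc 0 T) := by
  obtain ⟨lam, hlam, hsmall⟩ :=
    exists_pos_mul_one_div_rpow_mul_le_half hα hL (Real.Gamma_nonneg_of_nonneg hα.le)
  -- the unknown is `exp (-lam t) * Y t`, which makes the integral operator a contraction
  let N : C(Icc 0 T, ℝ) → ℝ → ℝ := fun u s => F s (Real.exp (lam * s) * IccExtend hT u s)
  have hN : ∀ u, Continuous (N u) := fun u => by
    have : Continuous (IccExtend hT u) := u.continuous.Icc_extend'
    exact hF.comp (continuous_id.prodMk (by fun_prop))
  let Φ : C(Icc 0 T, ℝ) → C(Icc 0 T, ℝ) := fun u =>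
    ⟨fun t => Real.exp (-(lam * t)) *
      (Z t + ∫ s in (0 : ℝ)..t, (t - s) ^ (α - 1) * N u s), by
      have h : Continuous fun t : Icc 0 T => ∫ s in (0 : ℝ)..t, (t - s) ^ (α - 1) * N u s :=
        (continuousOn_integral_sub_rpow_mul hα (hN u)).comp_continuous
          continuous_subtype_val fun t => t.2.1
      fun_prop⟩
  have hΦ : ContractingWith (1 / 2) Φ := by
    refine ⟨by norm_num, LipschitzWith.of_dist_le_mul fun u v => ?_⟩
    refine (ContinuousMap.dist_le (by positivity)).2 fun ⟨t, ht⟩ => ?_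
    have hD : ∀ s ∈ Ioc 0 t, ‖(t - s) ^ (α - 1) * N u s - (t - s) ^ (α - 1) * N v s‖ ≤
        Real.exp (lam * t) * (L * dist u v) *
          ((t - s) ^ (α - 1) * Real.exp (-(lam * (t - s)))) := by
      intro s hs
      have hsT : s ∈ Icc 0 T := ⟨hs.1.le, hs.2.trans ht.2⟩
      have hk : 0 ≤ (t - s) ^ (α - 1) := Real.rpow_nonneg (sub_nonneg.2 hs.2) _
      have h1 : |N u s - N v s| ≤ L * (Real.exp (lam * s) * dist u v) := by
        refine (hLip s hsT _ _).trans (mul_le_mul_of_nonneg_left ?_ hL)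
        rw [← mul_sub, abs_mul, abs_of_pos (Real.exp_pos _), IccExtend_of_mem hT _ hsT,
          IccExtend_of_mem hT _ hsT, ← Real.dist_eq]
        exact mul_le_mul_of_nonneg_left (ContinuousMap.dist_apply_le_dist _) (Real.exp_pos _).le
      have h2 : Real.exp (lam * s) = Real.exp (lam * t) * Real.exp (-(lam * (t - s))) := by
        rw [← Real.exp_add]; ring_nf
      rw [← mul_sub, norm_mul, Real.norm_of_nonneg hk, Real.norm_eq_abs]
      calc _ ≤ (t - s) ^ (α - 1) * (L * (Real.exp (lam * s) * dist u v)) := by gcongr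
        _ = _ := by rw [h2]; ring
    have hint := intervalIntegral.norm_integral_le_of_norm_le (μ := volume) ht.1
      (.of_forall hD) ((intervalIntegrable_sub_rpow_mul hα (by fun_prop) t 0 t).const_mul _)
    rw [intervalIntegral.integral_sub (intervalIntegrable_sub_rpow_mul hα (hN u) t 0 t)
      (intervalIntegrable_sub_rpow_mul hα (hN v) t 0 t),
      intervalIntegral.integral_const_mul] at hint
    have hmass := integral_sub_rpow_mul_exp_le hα hlam ht.1
    have hee : Real.exp (-(lam * t)) * Real.exp (lam * t) = 1 := by
      rw [← Real.exp_add]; simp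
    rw [Real.dist_eq]
    simp only [Φ, ContinuousMap.coe_mk]
    rw [← mul_sub, add_sub_add_left_eq_sub, abs_mul, abs_of_pos (Real.exp_pos _)]
    calc _ ≤ Real.exp (-(lam * t)) * (Real.exp (lam * t) * (L * dist u v) *
          ((1 / lam) ^ α * Real.Gamma α)) := by
          refine mul_le_mul_of_nonneg_left (hint.trans ?_) (Real.exp_pos _).le
          gcongr
      _ = L * ((1 / lam) ^ α * Real.Gamma α) * dist u v := by
          linear_combination (L * dist u v * ((1 / lam) ^ α * Real.Gamma α)) * hee
      _ ≤ 1 / 2 * dist u v := by gcongr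
      _ = _ := by norm_num
  obtain ⟨u, hu⟩ : ∃ u, Φ u = u :=
    ⟨_, ContractingWith.fixedPoint_isFixedPt (hf := hΦ)⟩
  have hee : ∀ t, Real.exp (lam * t) * Real.exp (-(lam * t)) = 1 := fun t => by
    rw [← Real.exp_add]; simp
  refine ⟨fun s => Real.exp (lam * s) * IccExtend hT u s, ?_, fun t ht => ?_,
    fun Y' hY' hsol t ht => ?_⟩
  · have : Continuous (IccExtend hT u) := u.continuous.Icc_extend'
    fun_prop
  · have h := DFunLike.congr_fun hu ⟨t, ht⟩
    simp only [Φ, ContinuousMap.coe_mk] at h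
    beta_reduce
    rw [IccExtend_of_mem hT _ ht, ← h, ← mul_assoc, hee, one_mul]
  · let w : C(Icc 0 T, ℝ) := ⟨fun t => Real.exp (-(lam * t)) * Y' t, by
      have := hY'.domRestrict
      exact (by fun_prop : Continuous fun t : Icc 0 T => Real.exp (-(lam * t))).mul this⟩
    have hw' : ∀ s ∈ Icc 0 T, Real.exp (lam * s) * IccExtend hT w s = Y' s := fun s hs => by
      rw [IccExtend_of_mem hT _ hs]
      simp only [w, ContinuousMap.coe_mk]
      rw [← mul_assoc, hee, one_mul]
    have hw : Φ w = w := by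
      ext ⟨t, ht⟩
      simp only [Φ, w, ContinuousMap.coe_mk]
      rw [hsol t ht]
      congr 2
      refine intervalIntegral.integral_congr fun s hs => ?_
      rw [uIcc_of_le ht.1] at hs
      simp only [N]
      rw [hw' s ⟨hs.1, hs.2.trans ht.2⟩]
    have : w = u := hΦ.fixedPoint_unique' hw hu
    rw [← hw' t ht, this]

/-- Abel-Volterra equations with a nonlinearity that is Lipschitz uniformly on compact time
intervals are uniquely solvable on `[0, ∞)`. -/
theorem abelVolterra_exists_unique_Ici {α : ℝ} (hα : 0 < α)
    {Z : ℝ → ℝ} (hZ : Continuous Z) {F : ℝ → ℝ → ℝ} (hF : Continuous (Function.uncurry F))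
    (hLip : ∀ T, 0 ≤ T → ∃ L, 0 ≤ L ∧ ∀ s ∈ Icc 0 T, ∀ x y, |F s x - F s y| ≤ L * |x - y|) :
    ∃ Y : ℝ → ℝ, ContinuousOn Y (Ici 0) ∧
      (∀ t, 0 ≤ t → Y t = Z t + ∫ s in (0 : ℝ)..t, (t - s) ^ (α - 1) * F s (Y s)) ∧
      ∀ Y' : ℝ → ℝ, ContinuousOn Y' (Ici 0) →
        (∀ t, 0 ≤ t → Y' t = Z t + ∫ s in (0 : ℝ)..t, (t - s) ^ (α - 1) * F s (Y' s)) →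
        ∀ t, 0 ≤ t → Y' t = Y t := by
  choose L hL hFL using fun n : ℕ => hLip n n.cast_nonneg
  choose y hyc hysol hyuniq using fun n : ℕ =>
    abelVolterra_exists_unique_Icc hα (hL n) n.cast_nonneg hZ hF (hFL n)
  have hmono : ∀ m n : ℕ, m ≤ n → EqOn (y n) (y m) (Icc 0 (m : ℝ)) := fun m n hmn => by
    have hsub : Icc (0 : ℝ) m ⊆ Icc 0 n := Icc_subset_Icc_right (by exact_mod_cast hmn)
    exact hyuniq m _ ((hyc n).mono hsub) fun t ht => hysol n t (hsub ht)
  have hY : ∀ n : ℕ, EqOn (fun t => y ⌈t⌉₊ t) (y n) (Icc 0 (n : ℝ)) := fun n t ht =>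
    (hmono _ _ (Nat.ceil_le.2 ht.2) ⟨ht.1, Nat.le_ceil t⟩).symm
  refine ⟨fun t => y ⌈t⌉₊ t, fun t ht => ?_, fun t ht => ?_, fun Y' hY' hsol t ht => ?_⟩
  · obtain ⟨n, hn⟩ := exists_nat_gt t
    have h := ((hyc n).congr (hY n)) t ⟨ht, hn.le⟩
    refine h.mono_of_mem_nhdsWithin ?_
    filter_upwards [self_mem_nhdsWithin, mem_nhdsWithin_of_mem_nhds (Iio_mem_nhds hn)]
      with s hs hs' using ⟨hs, le_of_lt hs'⟩
  · obtain ⟨n, hn⟩ := exists_nat_ge t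
    rw [hY n ⟨ht, hn⟩, hysol n t ⟨ht, hn⟩]
    congr 1
    refine intervalIntegral.integral_congr fun s hs => ?_
    rw [uIcc_of_le ht] at hs
    have := hY n ⟨hs.1, hs.2.trans hn⟩
    simp only at this ⊢
    rw [this]
  · exact hyuniq _ Y' (hY'.mono Icc_subset_Ici_self) (fun s hs => hsol s hs.1)
      ⟨ht, Nat.le_ceil t⟩

theorem abs_exp_sub_exp_le {x y M : ℝ} (hx : x ≤ M) (hy : y ≤ M) :
    |Real.exp x - Real.exp y| ≤ Real.exp M * |x - y| := by
  wlog h : y ≤ x generalizing x y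
  · rw [abs_sub_comm, abs_sub_comm x]
    exact this hy hx (le_of_not_ge h)
  rw [abs_of_nonneg (sub_nonneg.2 (Real.exp_le_exp.2 h)), abs_of_nonneg (sub_nonneg.2 h)]
  have h1 : Real.exp y = Real.exp x * Real.exp (y - x) := by rw [← Real.exp_add]; ring_nf
  calc Real.exp x - Real.exp y = Real.exp x * (1 - Real.exp (y - x)) := by rw [h1]; ring
    _ ≤ Real.exp x * (x - y) :=
      mul_le_mul_of_nonneg_left (by linarith [Real.add_one_le_exp (y - x)]) (Real.exp_pos x).le
    _ ≤ Real.exp M * (x - y) := by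
      have := sub_nonneg.2 h
      gcongr

theorem integral_roughBergomiKernel_mul {α η t : ℝ} (ht : 0 ≤ t) (b : ℝ) (f : ℝ → ℝ) :
    ∫ s in (0 : ℝ)..t, roughBergomiKernel α η t s * (b * f s) =
      ∫ s in (0 : ℝ)..t, (t - s) ^ (α - 1) * (η * Real.sqrt (2 * α - 1) * b * f s) := by
  refine intervalIntegral.integral_congr_Ioo_of_le ht fun s hs => ?_
  simp only [roughBergomiKernel, if_pos (And.intro hs.1.le hs.2)]
  ring

/-- **Pathwise existence and uniqueness for the drift-modified Volterra equation of
the rough Bergomi model.**  Fix `α > 1/2`, `η > 0`, `ρ ∈ [−1,0]`, `v₀ > 0`.  For every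
continuous `Z : [0,∞) → ℝ` with `Z(0) = 0` there is a unique continuous
`Ỹ : [0,∞) → ℝ` with
`Ỹ(t) = Z(t) + ∫_0^t K_{α,η}(t,s) ρ √v₀ exp(Ỹ(s)/2 − (η²/4) s^{2α−1}) ds` for all `t ≥ 0`. -/
theorem roughBergomi_drift_volterra_exists_unique
    (α η ρ v₀ : ℝ) (hα : 1 / 2 < α) (hη : 0 < η)
    (hρ : ρ ∈ Icc (-1 : ℝ) 0) (hv₀ : 0 < v₀)
    (Z : ℝ → ℝ) (hZ : ContinuousOn Z (Ici 0)) (hZ0 : Z 0 = 0) :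
    ∃ Y : ℝ → ℝ, ContinuousOn Y (Ici 0) ∧
      (∀ t, 0 ≤ t → Y t = Z t + ∫ s in (0 : ℝ)..t,
        roughBergomiKernel α η t s * (ρ * Real.sqrt v₀ *
          Real.exp (Y s / 2 - η ^ 2 / 4 * s ^ (2 * α - 1)))) ∧
      ∀ Y' : ℝ → ℝ, ContinuousOn Y' (Ici 0) →
        (∀ t, 0 ≤ t → Y' t = Z t + ∫ s in (0 : ℝ)..t,
          roughBergomiKernel α η t s * (ρ * Real.sqrt v₀ *
            Real.exp (Y' s / 2 - η ^ 2 / 4 * s ^ (2 * α - 1)))) →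
        ∀ t, 0 ≤ t → Y' t = Y t := by
  have hα0 : 0 < α := by linarith
  set c := η * Real.sqrt (2 * α - 1) * (ρ * Real.sqrt v₀) with hc_def
  have hc : c ≤ 0 := mul_nonpos_of_nonneg_of_nonpos (by positivity)
    (mul_nonpos_of_nonpos_of_nonneg hρ.2 (Real.sqrt_nonneg _))
  have hpow : Continuous fun s : ℝ => s ^ (2 * α - 1) :=
    Real.continuous_rpow_const (by linarith)
  -- a solution never exceeds `Z`, so the exponential may be truncated there
  let W : ℝ → ℝ := fun t => Z (max t 0)
  have hW : Continuous W :=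
    hZ.comp_continuous (continuous_id.max continuous_const) fun t => le_max_right t 0
  have hWZ : ∀ t, 0 ≤ t → W t = Z t := fun t ht => by simp only [W, max_eq_left ht]
  let F : ℝ → ℝ → ℝ := fun s y =>
    c * Real.exp (min y (W s) / 2 - η ^ 2 / 4 * s ^ (2 * α - 1))
  have hF : Continuous (Function.uncurry F) := by
    have h1 : Continuous fun p : ℝ × ℝ => W p.1 := hW.comp continuous_fst
    have h2 : Continuous fun p : ℝ × ℝ => p.1 ^ (2 * α - 1) := hpow.comp continuous_fst
    simp only [F, Function.uncurry_def]
    fun_prop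
  have hFLip : ∀ T, 0 ≤ T → ∃ L, 0 ≤ L ∧
      ∀ s ∈ Icc 0 T, ∀ x y, |F s x - F s y| ≤ L * |x - y| := fun T _ => by
    obtain ⟨M, hM⟩ := (isCompact_Icc (a := (0 : ℝ)) (b := T)).bddAbove_image
      (f := fun s => W s / 2 - η ^ 2 / 4 * s ^ (2 * α - 1)) (by fun_prop)
    refine ⟨|c| * Real.exp M, by positivity, fun s hs x y => ?_⟩
    have hle : ∀ z, min z (W s) / 2 - η ^ 2 / 4 * s ^ (2 * α - 1) ≤ M := fun z => by
      have h1 : W s / 2 - η ^ 2 / 4 * s ^ (2 * α - 1) ≤ M := hM (mem_image_of_mem _ hs)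
      linarith [min_le_right z (W s)]
    have hmin : |min x (W s) - min y (W s)| ≤ |x - y| := by
      simpa using abs_min_sub_min_le_max x (W s) y (W s)
    simp only [F]
    rw [← mul_sub, abs_mul, mul_assoc]
    refine mul_le_mul_of_nonneg_left ((abs_exp_sub_exp_le (hle x) (hle y)).trans
      (mul_le_mul_of_nonneg_left ?_ (Real.exp_pos _).le)) (abs_nonneg c)
    rw [sub_sub_sub_cancel_right, ← sub_div, abs_div, abs_two]
    linarith [abs_nonneg (min x (W s) - min y (W s))]
  have hint : ∀ g : ℝ → ℝ, ∀ t, 0 ≤ t →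
      ∫ s in (0 : ℝ)..t, (t - s) ^ (α - 1) * (c * Real.exp (g s)) ≤ 0 := fun g t ht => by
    rw [intervalIntegral.integral_of_le ht]
    refine setIntegral_nonpos measurableSet_Ioc fun s hs => ?_
    exact mul_nonpos_of_nonneg_of_nonpos (Real.rpow_nonneg (sub_nonneg.2 hs.2) _)
      (mul_nonpos_of_nonpos_of_nonneg hc (Real.exp_pos _).le)
  have htrunc : ∀ Y : ℝ → ℝ, (∀ t, 0 ≤ t → Y t ≤ Z t) → ∀ t, 0 ≤ t →
      ∫ s in (0 : ℝ)..t, (t - s) ^ (α - 1) *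
        (c * Real.exp (Y s / 2 - η ^ 2 / 4 * s ^ (2 * α - 1))) =
      ∫ s in (0 : ℝ)..t, (t - s) ^ (α - 1) * F s (Y s) := fun Y hYZ t ht => by
    refine intervalIntegral.integral_congr fun s hs => ?_
    rw [uIcc_of_le ht] at hs
    simp only [F]
    rw [hWZ s hs.1, min_eq_left (hYZ s hs.1)]
  obtain ⟨Y, hYc, hY, huniq⟩ := abelVolterra_exists_unique_Ici hα0 hW hF hFLip
  refine ⟨Y, hYc, fun t ht => ?_, fun Y' hYc' hY' => huniq Y' hYc' fun t ht => ?_⟩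
  · have hYZ : ∀ t, 0 ≤ t → Y t ≤ Z t := fun t ht => by
      rw [hY t ht, hWZ t ht]
      linarith [hint (fun s => min (Y s) (W s) / 2 - η ^ 2 / 4 * s ^ (2 * α - 1)) t ht]
    rw [integral_roughBergomiKernel_mul ht, ← hc_def, htrunc Y hYZ t ht, hY t ht, hWZ t ht]
  · have hYZ : ∀ t, 0 ≤ t → Y' t ≤ Z t := fun t ht => by
      rw [hY' t ht, integral_roughBergomiKernel_mul ht, ← hc_def]
      linarith [hint (fun s => Y' s / 2 - η ^ 2 / 4 * s ^ (2 * α - 1)) t ht]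
    rw [← htrunc Y' hYZ t ht, hWZ t ht, hY' t ht, integral_roughBergomiKernel_mul ht, ← hc_def]
end

section
/- Let q : (0,1) → ℝ be nondecreasing and Lebesgue-integrable, and let H(t) = (1/(1−t)) ∫_t^1 q(s) ds for t ∈ [0,1). If ∫_0^1 max(q(s),0)·log⁺(q(s)) ds = ∞, then ∫_0^1 max(H(t),0) dt = ∞; in particular, H is not Lebesgue-integrable on (0,1). -/
open MeasureTheory Filter Set
open scoped ENNReal

lemma lintegral_Ioo_inv_one_sub {a s : ℝ} (has : a < s) (hs : s < 1) :
    ∫⁻ t in Ioo a s, ENNReal.ofReal (1 - t)⁻¹ = ENNReal.ofReal (Real.log ((1 - a) / (1 - s))) := by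
  have hcont : ContinuousOn (fun t : ℝ => (1 - t)⁻¹) (Icc a s) := by
    refine ContinuousOn.inv₀ (by fun_prop) fun t ht => ?_
    linarith [ht.2]
  rw [← ofReal_integral_eq_lintegral_ofReal]
  · congr 1
    rw [← integral_Ioc_eq_integral_Ioo, ← intervalIntegral.integral_of_le has.le,
      intervalIntegral.integral_comp_sub_left (fun x : ℝ => x⁻¹) 1,
      integral_inv_of_pos (by linarith) (by linarith)]
  · exact hcont.integrableOn_Icc.mono_set Ioo_subset_Icc_self
  · filter_upwards [ae_restrict_mem measurableSet_Ioo] with t ht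
    exact inv_nonneg.2 (by linarith [ht.2])

/-- Tonelli's theorem for the average `(1 - t)⁻¹ * ∫ s in Ioo t 1, q s`. -/
lemma lintegral_tail_average_eq {q : ℝ → ℝ} {a : ℝ} (hq : IntegrableOn q (Ioo a 1))
    (hq0 : ∀ s ∈ Ioo a 1, 0 ≤ q s) :
    ∫⁻ t in Ioo a 1, ENNReal.ofReal ((1 - t)⁻¹ * ∫ s in Ioo t 1, q s) =
      ∫⁻ s in Ioo a 1, ENNReal.ofReal (q s) * ENNReal.ofReal (Real.log ((1 - a) / (1 - s))) := by
  let F : ℝ → ℝ → ℝ≥0∞ := fun t s =>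
    {p : ℝ × ℝ | p.1 < p.2}.indicator
      (fun p => ENNReal.ofReal (1 - p.1)⁻¹ * ENNReal.ofReal (q p.2)) (t, s)
  have hF : AEMeasurable (Function.uncurry F)
      ((volume.restrict (Ioo a 1)).prod (volume.restrict (Ioo a 1))) := by
    refine AEMeasurable.indicator ?_ (measurableSet_lt measurable_fst measurable_snd)
    have hinv : Measurable fun p : ℝ × ℝ => ENNReal.ofReal (1 - p.1)⁻¹ := by fun_prop
    exact hinv.aemeasurable.mul (hq.aestronglyMeasurable.aemeasurable.ennreal_ofReal).comp_snd
  calc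
    _ = ∫⁻ t in Ioo a 1, ∫⁻ s in Ioo a 1, F t s := by
      refine setLIntegral_congr_fun measurableSet_Ioo fun t ht => ?_
      have hsub : Ioo t 1 ⊆ Ioo a 1 := Ioo_subset_Ioo_left ht.1.le
      have hFt : F t = (Ioi t).indicator
          (fun s => ENNReal.ofReal (1 - t)⁻¹ * ENNReal.ofReal (q s)) := by
        ext s
        simp [F, indicator]
      have hinter : Ioi t ∩ Ioo a 1 = Ioo t 1 := by
        ext s
        simp only [mem_inter_iff, mem_Ioi, mem_Ioo]
        exact ⟨fun h => ⟨h.1, h.2.2⟩, fun h => ⟨h.1, ht.1.trans h.1, h.2⟩⟩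
      simp only [hFt]
      rw [setLIntegral_indicator measurableSet_Ioi, hinter,
        lintegral_const_mul' _ _ ENNReal.ofReal_ne_top,
        ENNReal.ofReal_mul (inv_nonneg.2 (by linarith [ht.2])),
        ofReal_integral_eq_lintegral_ofReal (hq.mono_set hsub)]
      filter_upwards [ae_restrict_mem measurableSet_Ioo] with s hs
      exact hq0 s (hsub hs)
    _ = ∫⁻ s in Ioo a 1, ∫⁻ t in Ioo a 1, F t s := lintegral_lintegral_swap hF
    _ = _ := by
      refine setLIntegral_congr_fun measurableSet_Ioo fun s hs => ?_
      have hFs : (fun t => F t s) = (Iio s).indicator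
          (fun t => ENNReal.ofReal (1 - t)⁻¹ * ENNReal.ofReal (q s)) := by
        ext t
        simp [F, indicator]
      have hinter : Iio s ∩ Ioo a 1 = Ioo a s := by
        ext t
        simp only [mem_inter_iff, mem_Iio, mem_Ioo]
        exact ⟨fun h => ⟨h.2.1, h.1⟩, fun h => ⟨h.2, h.1, h.2.trans hs.2⟩⟩
      simp only [hFs]
      rw [setLIntegral_indicator measurableSet_Iio, hinter,
        lintegral_mul_const' _ _ ENNReal.ofReal_ne_top, lintegral_Ioo_inv_one_sub hs.1 hs.2,
        mul_comm]

lemma MonotoneOn.mul_one_sub_le_setIntegral {q : ℝ → ℝ} {a s : ℝ} (hmono : MonotoneOn q (Ioo a 1))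
    (hq : IntegrableOn q (Ioo a 1)) (hq0 : ∀ s ∈ Ioo a 1, 0 ≤ q s) (hs : s ∈ Ioo a 1) :
    q s * (1 - s) ≤ ∫ u in Ioo a 1, q u := by
  have hsub : Ioo s 1 ⊆ Ioo a 1 := Ioo_subset_Ioo_left hs.1.le
  calc
    q s * (1 - s) = ∫ _ in Ioo s 1, q s := by
      simp [max_eq_left (sub_nonneg.2 hs.2.le), mul_comm]
    _ ≤ ∫ u in Ioo s 1, q u :=
      setIntegral_mono_on (integrableOn_const (by simp)) (hq.mono_set hsub) measurableSet_Ioo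
        fun u hu => hmono hs (hsub hu) hu.1.le
    _ ≤ ∫ u in Ioo a 1, q u := by
      refine setIntegral_mono_set hq ?_ hsub.eventuallyLE
      filter_upwards [ae_restrict_mem measurableSet_Ioo] with u hu
      exact hq0 u hu

/-- On an interval where `q ≥ 1`, integrability of the tail averages forces `q log q` to be
integrable. -/
lemma lintegral_mul_log_ne_top {q : ℝ → ℝ} {a : ℝ} (ha : a < 1) (hmono : MonotoneOn q (Ioo a 1))
    (hq : IntegrableOn q (Ioo a 1)) (hq1 : ∀ s ∈ Ioo a 1, 1 ≤ q s)
    (hfin : ∫⁻ t in Ioo a 1, ENNReal.ofReal ((1 - t)⁻¹ * ∫ s in Ioo t 1, q s) ≠ ⊤) :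
    ∫⁻ s in Ioo a 1, ENNReal.ofReal (max (q s) 0 * max (Real.log (q s)) 0) ≠ ⊤ := by
  have hq0 : ∀ s ∈ Ioo a 1, 0 ≤ q s := fun s hs => zero_le_one.trans (hq1 s hs)
  rw [lintegral_tail_average_eq hq hq0] at hfin
  set C := ∫ u in Ioo a 1, q u with hC
  set K := |Real.log (C / (1 - a))| with hK
  have hbound : ∀ s ∈ Ioo a 1, ENNReal.ofReal (max (q s) 0 * max (Real.log (q s)) 0) ≤
      ENNReal.ofReal (q s) * ENNReal.ofReal (Real.log ((1 - a) / (1 - s))) +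
        ENNReal.ofReal (q s * K) := by
    intro s hs
    have hs1 : 0 < 1 - s := by linarith [hs.2]
    have ha1 : 0 < 1 - a := by linarith
    have hqs : 0 < q s := zero_lt_one.trans_le (hq1 s hs)
    have hle : q s * (1 - s) ≤ C := hmono.mul_one_sub_le_setIntegral hq hq0 hs
    have hC0 : 0 < C := (mul_pos hqs hs1).trans_le hle
    have hlog : 0 ≤ Real.log ((1 - a) / (1 - s)) :=
      Real.log_nonneg ((one_le_div hs1).2 (by linarith [hs.1]))
    have hlogq : Real.log (q s) ≤ Real.log ((1 - a) / (1 - s)) + K := by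
      have h := Real.log_le_log (mul_pos hqs hs1) hle
      rw [Real.log_mul hqs.ne' hs1.ne'] at h
      have hKle : Real.log (C / (1 - a)) ≤ K := le_abs_self _
      rw [Real.log_div hC0.ne' ha1.ne'] at hKle
      rw [Real.log_div ha1.ne' hs1.ne']
      linarith
    rw [← ENNReal.ofReal_mul hqs.le,
      ← ENNReal.ofReal_add (mul_nonneg hqs.le hlog) (mul_nonneg hqs.le (abs_nonneg _)),
      max_eq_left hqs.le, max_eq_left (Real.log_nonneg (hq1 s hs)), ← mul_add]
    exact ENNReal.ofReal_le_ofReal (mul_le_mul_of_nonneg_left hlogq hqs.le)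
  refine ne_top_of_le_ne_top ?_ (setLIntegral_mono' measurableSet_Ioo hbound)
  rw [lintegral_add_right' _ (hq.mul_const K).aestronglyMeasurable.aemeasurable.ennreal_ofReal]
  exact ENNReal.add_ne_top.2 ⟨hfin, (hq.mul_const K).lintegral_lt_top.ne⟩

/-- **Stein's theorem (the direction used in the paper).**  Let `q : (0,1) → ℝ` be
nondecreasing and Lebesgue-integrable and let
`H(t) = (1/(1−t)) ∫_t^1 q(s) ds` be its Hardy–Littlewood maximal function.
If `∫_0^1 max(q(s),0) log⁺(q(s)) ds = ∞`, then `∫_0^1 max(H(t),0) dt = ∞`;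
in particular `H` is not Lebesgue-integrable on `(0,1)`. -/
theorem hardyLittlewood_maximal_not_integrable
    (q : ℝ → ℝ) (hq_mono : MonotoneOn q (Ioo 0 1))
    (hq_int : IntegrableOn q (Ioo 0 1))
    (H : ℝ → ℝ) (hH : ∀ t, H t = (1 - t)⁻¹ * ∫ s in Ioo t 1, q s)
    (hLlogL : ∫⁻ s in Ioo (0 : ℝ) 1,
        ENNReal.ofReal (max (q s) 0 * max (Real.log (q s)) 0) = ⊤) :
    (∫⁻ t in Ioo (0 : ℝ) 1, ENNReal.ofReal (max (H t) 0) = ⊤) ∧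
      ¬ IntegrableOn H (Ioo 0 1) := by
  have htop : ∫⁻ t in Ioo (0 : ℝ) 1, ENNReal.ofReal (H t) = ⊤ := by
    by_contra hfin
    obtain ⟨a, ha, hqa⟩ : ∃ a ∈ Ioo (0 : ℝ) 1, 1 ≤ q a := by
      by_contra! hlt
      have hzero : ∫⁻ s in Ioo (0 : ℝ) 1,
          ENNReal.ofReal (max (q s) 0 * max (Real.log (q s)) 0) = 0 := by
        rw [setLIntegral_congr_fun (g := fun _ => 0) measurableSet_Ioo, lintegral_zero]
        intro s hs
        rcases le_total (q s) 0 with h | h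
        · simp [h]
        · simp [Real.log_nonpos h (hlt s hs).le]
      exact ENNReal.zero_ne_top (hzero.symm.trans hLlogL)
    have hsub : Ioo a 1 ⊆ Ioo 0 1 := Ioo_subset_Ioo_left ha.1.le
    have hleft : ∫⁻ s in Ioc 0 a,
        ENNReal.ofReal (max (q s) 0 * max (Real.log (q s)) 0) ≠ ⊤ := by
      have hbound : ∀ s ∈ Ioc 0 a, ENNReal.ofReal (max (q s) 0 * max (Real.log (q s)) 0) ≤
          ENNReal.ofReal (q a * Real.log (q a)) := by
        intro s hs
        have hqs : q s ≤ q a := hq_mono ⟨hs.1, hs.2.trans_lt ha.2⟩ ha hs.2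
        have hloga : 0 ≤ Real.log (q a) := Real.log_nonneg hqa
        refine ENNReal.ofReal_le_ofReal ?_
        rcases le_or_gt (q s) 0 with h | h
        · rw [max_eq_right h, zero_mul]
          positivity
        · exact mul_le_mul (max_le hqs (by linarith)) (max_le (Real.log_le_log h hqs) hloga)
            (le_max_right _ _) (by linarith)
      refine ne_top_of_le_ne_top ?_ (setLIntegral_mono' measurableSet_Ioc hbound)
      simp [ENNReal.mul_eq_top]
    have hright : ∫⁻ s in Ioo a 1,
        ENNReal.ofReal (max (q s) 0 * max (Real.log (q s)) 0) ≠ ⊤ := by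
      refine lintegral_mul_log_ne_top ha.2 (hq_mono.mono hsub) (hq_int.mono_set hsub)
        (fun s hs => hqa.trans (hq_mono ha (hsub hs) hs.1.le)) ?_
      simp only [← hH]
      exact ne_top_of_le_ne_top hfin (lintegral_mono_set hsub)
    rw [← Ioc_union_Ioo_eq_Ioo ha.1.le ha.2] at hLlogL
    exact ne_top_of_le_ne_top (ENNReal.add_ne_top.2 ⟨hleft, hright⟩)
      (lintegral_union_le _ _ _) hLlogL
  refine ⟨?_, fun hint => hint.lintegral_lt_top.ne htop⟩
  simpa [ENNReal.ofReal_max] using htop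
end

section
/- On the probability space ((0,1), Borel σ-algebra, Lebesgue measure), let q : (0,1) → ℝ be nondecreasing and Lebesgue-integrable, and define the process X_t(s) = H(t) for t ≤ s and X_t(s) = q(s) for t > s, for t ∈ [0,1] and s ∈ (0,1), where H(t) = (1/(1−t)) ∫_t^1 q(u) du. Let F_t be the σ-algebra generated by U·1_{U<t}, where U(s) = s (with F_1 the full Borel σ-algebra). Then (X_t)_{t∈[0,1]} is a martingale with respect to the filtration (F_t)_{t∈[0,1]}. -/
open MeasureTheory Filter Set
open scoped ENNReal

attribute [local instance] MeasureTheory.Measure.Subtype.measureSpace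

/-- Averaging an integrable function over the upper end of an interval preserves its integral
over any larger upper end. -/
theorem setIntegral_Ioo_ite_average {f : ℝ → ℝ} {s t b : ℝ} (hf : IntegrableOn f (Ioo s b))
    (hst : s ≤ t) (htb : t ≤ b) :
    ∫ u in Ioo s b, (if t ≤ u then (b - t)⁻¹ * ∫ v in Ioo t b, f v else f u)
      = ∫ u in Ioo s b, f u := by
  set c := (b - t)⁻¹ * ∫ v in Ioo t b, f v with hc
  have hdisj : Disjoint (Ioo s t) (Ico t b) :=
    Set.disjoint_left.2 fun u hu hu' => not_le.2 hu.2 hu'.1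
  have hsplit : (Ioo s b : Set ℝ) =ᵐ[volume] (Ioo s t ∪ Ico t b : Set ℝ) := by
    rcases hst.eq_or_lt with rfl | hst
    · simpa using Ioo_ae_eq_Ico
    · rcases htb.eq_or_lt with rfl | htb
      · rw [Ico_self, union_empty]
        exact ae_eq_refl _
      · rw [Ioo_union_Ico_eq_Ioo hst htb.le]
        exact ae_eq_refl _
  have hfl : IntegrableOn f (Ioo s t) := hf.mono_set (Ioo_subset_Ioo_right htb)
  have hfr : IntegrableOn f (Ico t b) :=
    (hf.mono_set (Ioo_subset_Ioo_left hst)).congr_set_ae Ioo_ae_eq_Ico.symm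
  have hl : EqOn f (fun u => if t ≤ u then c else f u) (Ioo s t) := fun u hu => by
    simp [not_le.2 hu.2]
  have hr : EqOn (fun _ => c) (fun u => if t ≤ u then c else f u) (Ico t b) := fun u hu => by
    simp [hu.1]
  have hcr : IntegrableOn (fun _ : ℝ => c) (Ico t b) :=
    integrableOn_const (by simp)
  rw [setIntegral_congr_set hsplit, setIntegral_congr_set hsplit,
    setIntegral_union hdisj measurableSet_Ico (hfl.congr_fun hl measurableSet_Ioo)
      (hcr.congr_fun hr measurableSet_Ico),
    setIntegral_union hdisj measurableSet_Ico hfl hfr,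
    ← setIntegral_congr_fun measurableSet_Ioo hl, ← setIntegral_congr_fun measurableSet_Ico hr,
    setIntegral_const, integral_Ico_eq_integral_Ioo]
  congr 1
  rcases htb.eq_or_lt with rfl | htb
  · simp
  · have : b - t ≠ 0 := (sub_pos.2 htb).ne'
    simp [hc, Measure.real, htb.le, this]

/-- **The Dubins–Gilat process is a martingale.**  On the probability space
`((0,1), Borel, Lebesgue)`, let `q` be nondecreasing and Lebesgue-integrable on
`(0,1)`, let `H(t) = (1/(1−t)) ∫_t^1 q(u) du`, and define
`X_t(s) = H(t)` for `t ≤ s` and `X_t(s) = q(s)` for `t > s`.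
With `F_t` the σ-algebra generated by `U·1_{U<t}` (`U(s) = s`; for `t = 1` this is
the full Borel σ-algebra of `(0,1)`), the process `(X_t)_{t∈[0,1]}` is a martingale
with respect to `(F_t)_{t∈[0,1]}`: it is integrable, adapted, and satisfies
`E[X_t | F_s] = X_s` a.s. for all `s ≤ t` in `[0,1]`. -/
theorem dubinsGilat_process_martingale
    (q : ℝ → ℝ) (hq_mono : MonotoneOn q (Ioo 0 1))
    (hq_int : IntegrableOn q (Ioo 0 1))
    (H : ℝ → ℝ) (hH : ∀ t, H t = (1 - t)⁻¹ * ∫ u in Ioo t 1, q u)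
    (X : ℝ → Ioo (0 : ℝ) 1 → ℝ)
    (hX : ∀ t (ω : Ioo (0 : ℝ) 1), X t ω = if t ≤ (ω : ℝ) then H t else q ω)
    (m : ℝ → MeasurableSpace (Ioo (0 : ℝ) 1))
    (hm : ∀ t, m t = MeasurableSpace.comap
      (fun ω : Ioo (0 : ℝ) 1 => if (ω : ℝ) < t then (ω : ℝ) else 0) inferInstance) :
    (∀ t ∈ Icc (0 : ℝ) 1, Integrable (X t) (volume : Measure (Ioo (0 : ℝ) 1))) ∧
    (∀ t ∈ Icc (0 : ℝ) 1, Measurable[m t] (X t)) ∧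
    (∀ s ∈ Icc (0 : ℝ) 1, ∀ t ∈ Icc (0 : ℝ) 1, s ≤ t →
      (volume : Measure (Ioo (0 : ℝ) 1))[X t | m s]
        =ᵐ[(volume : Measure (Ioo (0 : ℝ) 1))] X s) := by
  have hemb : MeasurableEmbedding (Subtype.val : Ioo (0 : ℝ) 1 → ℝ) :=
    MeasurableEmbedding.subtype_coe measurableSet_Ioo
  have hmp : MeasurePreserving (Subtype.val : Ioo (0 : ℝ) 1 → ℝ) volume
      (volume.restrict (Ioo 0 1)) := measurePreserving_subtype_coe measurableSet_Ioo
  have : IsFiniteMeasure (volume : Measure (Ioo (0 : ℝ) 1)) :=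
    ⟨by rw [Measure.Subtype.volume_univ measurableSet_Ioo.nullMeasurableSet]; simp⟩
  have hqi : Integrable (fun ω : Ioo (0 : ℝ) 1 => q ω) :=
    (hmp.integrable_comp_emb hemb).2 hq_int
  have hqm : Measurable (fun ω : Ioo (0 : ℝ) 1 => q ω) :=
    Monotone.measurable fun a b hab => hq_mono a.2 b.2 hab
  have hle : ∀ t, m t ≤ (inferInstance : MeasurableSpace (Ioo (0 : ℝ) 1)) := fun t => by
    rw [hm]
    exact Measurable.comap_le
      (Measurable.ite (measurable_subtype_coe measurableSet_Iio) measurable_subtype_coe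
        measurable_const)
  have hXm : ∀ t, Measurable[m t] (X t) := fun t => by
    have hg : Measurable
        (Function.extend (Subtype.val : Ioo (0 : ℝ) 1 → ℝ) (fun ω => q ω) fun _ => H t) :=
      hemb.measurable_extend hqm measurable_const
    have hfac : X t = Function.extend (Subtype.val : Ioo (0 : ℝ) 1 → ℝ) (fun ω => q ω)
        (fun _ => H t) ∘ fun ω : Ioo (0 : ℝ) 1 => if (ω : ℝ) < t then (ω : ℝ) else 0 := by
      funext ω
      by_cases h : (ω : ℝ) < t
      · simp [hX, h]
      · rw [Function.comp_apply, if_neg h, Function.extend_apply', hX, if_pos (not_lt.1 h)]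
        rintro ⟨a, ha⟩
        exact a.2.1.ne' ha
    rw [hfac, hm]
    exact hg.comp (comap_measurable _)
  have hXi : ∀ t, Integrable (X t) := fun t => by
    refine ((integrable_const |H t|).add hqi.norm).mono'
      ((hXm t).mono (hle t) le_rfl).aestronglyMeasurable (ae_of_all _ fun ω => ?_)
    rw [hX, Pi.add_apply]
    split_ifs
    · exact le_add_of_nonneg_right (norm_nonneg _)
    · exact le_add_of_nonneg_left (abs_nonneg _)
  have htail : ∀ s t, 0 ≤ s → s ≤ t → t ≤ 1 →
      ∫ ω in Subtype.val ⁻¹' Ici s, X t ω = ∫ u in Ioo s 1, q u := fun s t hs hst ht => by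
    have hset : (Ici s ∩ Ioo 0 1 : Set ℝ) =ᵐ[volume] (Ioo s 1 : Set ℝ) := by
      have h : (Ioi s ∩ Ioo 0 1 : Set ℝ) = Ioo s 1 := by
        ext u
        exact ⟨fun h => ⟨h.1, h.2.2⟩, fun h => ⟨h.1, hs.trans_lt h.1, h.2⟩⟩
      rw [← h]
      exact Ioi_ae_eq_Ici.symm.inter (ae_eq_refl _)
    simp only [hX]
    rw [hmp.setIntegral_preimage_emb hemb (fun u => if t ≤ u then H t else q u),
      Measure.restrict_restrict measurableSet_Ici, setIntegral_congr_set hset, hH]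
    exact setIntegral_Ioo_ite_average (hq_int.mono_set (Ioo_subset_Ioo_left hs)) hst ht
  refine ⟨fun t _ => hXi t, fun t _ => hXm t, fun s hs t ht hst => ?_⟩
  refine (ae_eq_condExp_of_forall_setIntegral_eq (hle s) (hXi t)
    (fun _ _ _ => (hXi s).integrableOn) ?_ (hXm s).stronglyMeasurable.aestronglyMeasurable).symm
  intro A hA _
  have hAm : MeasurableSet A := hle s A hA
  have hT : MeasurableSet (Subtype.val ⁻¹' Ici s : Set (Ioo (0 : ℝ) 1)) :=
    measurable_subtype_coe measurableSet_Ici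
  rw [← integral_inter_add_sdiff hT (hXi s).integrableOn,
    ← integral_inter_add_sdiff hT (hXi t).integrableOn]
  congr 1
  · rw [hm] at hA
    obtain ⟨B, -, rfl⟩ := hA
    have hpre : ∀ ω ∈ (Subtype.val ⁻¹' Ici s : Set (Ioo (0 : ℝ) 1)),
        (if (ω : ℝ) < s then (ω : ℝ) else 0) = 0 := fun ω hω => if_neg (not_lt.2 hω)
    by_cases h0 : (0 : ℝ) ∈ B
    · rw [inter_eq_right.2 fun ω hω => by rwa [mem_preimage, hpre ω hω],
        htail s s hs.1 le_rfl hs.2, htail s t hs.1 hst ht.2]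
    · rw [(disjoint_left.2 fun ω hωB hω => h0 (by rwa [mem_preimage, hpre ω hω] at hωB)
        : Disjoint _ _).inter_eq]
      simp
  · refine setIntegral_congr_fun (hAm.diff hT) fun ω hω => ?_
    have hωs : (ω : ℝ) < s := not_le.1 hω.2
    simp only [hX, if_neg (not_le.2 hωs), if_neg (not_le.2 (hωs.trans_le hst))]
end

section
/- On the probability space ((0,1), Borel σ-algebra, Lebesgue measure), let q : (0,1) → ℝ be nondecreasing and Lebesgue-integrable, and define the process X_t(s) = H(t) for t ≤ s and X_t(s) = q(s) for t > s, for t ∈ [0,1] and s ∈ (0,1), where H(t) = (1/(1−t)) ∫_t^1 q(u) du. Then for every s ∈ (0,1), sup_{t∈[0,1]} X_t(s) = H(s). -/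
open MeasureTheory Filter Set
open scoped ENNReal

theorem MonotoneOn.mul_le_setIntegral_Ioo {q : ℝ → ℝ} {a b s : ℝ}
    (hq : MonotoneOn q (Ioo a b)) (hint : IntegrableOn q (Ioo a b)) (hs : s ∈ Ioo a b) :
    (b - s) * q s ≤ ∫ u in Ioo s b, q u := by
  have h : ∫ _ in Ioo s b, q s ≤ ∫ u in Ioo s b, q u :=
    setIntegral_mono_on (integrableOn_const (by simp)) (hint.mono_set (Ioo_subset_Ioo_left hs.1.le))
      measurableSet_Ioo fun u hu => hq hs ⟨hs.1.trans hu.1, hu.2⟩ hu.1.le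
  simpa [hs.2.le] using h

theorem MonotoneOn.setIntegral_Ioc_le_mul {q : ℝ → ℝ} {a b t s : ℝ}
    (hq : MonotoneOn q (Ioo a b)) (hint : IntegrableOn q (Ioo a b)) (hs : s ∈ Ioo a b)
    (hat : a ≤ t) (hts : t ≤ s) :
    ∫ u in Ioc t s, q u ≤ (s - t) * q s := by
  have hsub : Ioc t s ⊆ Ioo a b := fun u hu => ⟨hat.trans_lt hu.1, hu.2.trans_lt hs.2⟩
  have h : ∫ u in Ioc t s, q u ≤ ∫ _ in Ioc t s, q s :=
    setIntegral_mono_on (hint.mono_set hsub) (integrableOn_const (by simp))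
      measurableSet_Ioc fun u hu => hq (hsub hu) hs hu.2
  simpa [hts] using h

/-- The average of a monotone function over `(t, b)` is nondecreasing in `t`. -/
theorem MonotoneOn.average_Ioo_le_average_Ioo {q : ℝ → ℝ} {a b t s : ℝ}
    (hq : MonotoneOn q (Ioo a b)) (hint : IntegrableOn q (Ioo a b)) (hs : s ∈ Ioo a b)
    (hat : a ≤ t) (hts : t ≤ s) :
    (b - t)⁻¹ * ∫ u in Ioo t b, q u ≤ (b - s)⁻¹ * ∫ u in Ioo s b, q u := by
  have hsub : Ioc t s ⊆ Ioo a b := fun u hu => ⟨hat.trans_lt hu.1, hu.2.trans_lt hs.2⟩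
  have hsplit : ∫ u in Ioo t b, q u = (∫ u in Ioc t s, q u) + ∫ u in Ioo s b, q u := by
    rw [← Ioc_union_Ioo_eq_Ioo hts hs.2]
    exact setIntegral_union (disjoint_left.2 fun u hu hv => hu.2.not_gt hv.1) measurableSet_Ioo
      (hint.mono_set hsub) (hint.mono_set (Ioo_subset_Ioo_left hs.1.le))
  have hA := hq.setIntegral_Ioc_le_mul hint hs hat hts
  have hB := hq.mul_le_setIntegral_Ioo hint hs
  have hbs : 0 < b - s := sub_pos.2 hs.2
  have hbt : 0 < b - t := by linarith
  rw [hsplit, inv_mul_eq_div, inv_mul_eq_div, div_le_div_iff₀ hbt hbs]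
  have h₁ := mul_le_mul_of_nonneg_left hA hbs.le
  have h₂ := mul_le_mul_of_nonneg_left hB (sub_nonneg.2 hts)
  linarith

/-- **The running supremum of the Dubins–Gilat process.**  Let `q` be nondecreasing
and Lebesgue-integrable on `(0,1)`, `H(t) = (1/(1−t)) ∫_t^1 q(u) du`, and
`X_t(s) = H(t)` for `t ≤ s`, `X_t(s) = q(s)` for `t > s`.  Then for every
`s ∈ (0,1)`, `sup_{t∈[0,1]} X_t(s) = H(s)`. -/
theorem dubinsGilat_process_sup
    (q : ℝ → ℝ) (hq_mono : MonotoneOn q (Ioo 0 1))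
    (hq_int : IntegrableOn q (Ioo 0 1))
    (H : ℝ → ℝ) (hH : ∀ t, H t = (1 - t)⁻¹ * ∫ u in Ioo t 1, q u)
    (X : ℝ → ℝ → ℝ)
    (hX : ∀ t s, X t s = if t ≤ s then H t else q s) :
    ∀ s ∈ Ioo (0 : ℝ) 1, (⨆ t : Icc (0 : ℝ) 1, X t s) = H s := by
  intro s hs
  have hle : ∀ t : Icc (0 : ℝ) 1, X t s ≤ H s := by
    intro t
    rw [hX]
    split_ifs with hts
    · rw [hH, hH]
      exact hq_mono.average_Ioo_le_average_Ioo hq_int hs t.2.1 hts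
    · rw [hH, inv_mul_eq_div, le_div_iff₀ (sub_pos.2 hs.2), mul_comm]
      exact hq_mono.mul_le_setIntegral_Ioo hq_int hs
  have : Nonempty (Icc (0 : ℝ) 1) := ⟨⟨s, hs.1.le, hs.2.le⟩⟩
  refine le_antisymm (ciSup_le hle) ?_
  have h := le_ciSup (f := fun t : Icc (0 : ℝ) 1 => X t s) ⟨H s, forall_mem_range.2 hle⟩
    ⟨s, hs.1.le, hs.2.le⟩
  simpa only [hX, le_refl, if_true] using h
end

section
/- Let (Ω, F, (G_t)_{t≥0}, P) be a filtered probability space and let (M_t)_{t≥0} be a non-negative, right-continuous, adapted supermartingale. For n ∈ ℕ let τ_n = inf{t ≥ 0 : M_t > n}, and assume that for every n the stopped process (M_{t∧τ_n})_{t≥0} is a uniformly integrable martingale closed by its almost sure limit M^{τ_n}_∞, i.e. M_{t∧τ_n} = E[M^{τ_n}_∞ | G_t] a.s. for all t, with E[M^{τ_n}_∞] = E[M_0]. Let Y be an ℕ-valued, G_0-measurable random variable independent of the σ-algebra generated by (M_t)_{t≥0}, and let σ = inf{t ≥ 0 : M_t > Y}. Then the stopped process (M_{t∧σ})_{t≥0}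 is a uniformly integrable martingale; in particular its almost sure limit M^σ_∞ exists and E[M^σ_∞] = E[M_0]. -/
open MeasureTheory Filter Set
open scoped ENNReal NNReal Classical

/-- A right-continuous process whose values up to time `t` are measurable remains measurable when
sampled at a measurable random time bounded by `t`. -/
theorem measurable_sample_of_rightContinuous {Ω : Type*} {m : MeasurableSpace Ω}
    {X : ℝ≥0 → Ω → ℝ} {t : ℝ≥0} {ρ : Ω → ℝ≥0}
    (hX : ∀ u ≤ t, Measurable (X u))
    (hrc : ∀ ω u, ContinuousWithinAt (fun v => X v ω) (Ici u) u)
    (hρ : Measurable ρ) (hρt : ∀ ω, ρ ω ≤ t) :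
    Measurable fun ω => X (ρ ω) ω := by
  let g : ℕ → ℕ → ℝ≥0 := fun k j => min t (((j : ℝ≥0) + 1) / ((k : ℝ≥0) + 1))
  let d : ℕ → Ω → ℕ := fun k ω => ⌊ρ ω * ((k : ℝ≥0) + 1)⌋₊
  refine measurable_of_tendsto_metrizable (f := fun k ω => X (g k (d k ω)) ω) (fun k => ?_) ?_
  · have hd : Measurable (d k) := Nat.measurable_floor.comp (hρ.mul_const _)
    have hF : Measurable fun p : ℕ × Ω => X (g k p.1) p.2 :=
      measurable_from_prod_countable_right fun j =>
        hX (g k j) (min_le_left _ _)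
    have hcomp := hF.comp (hd.prodMk measurable_id)
    simpa only [Function.comp_def, id] using hcomp
  · refine tendsto_pi_nhds.2 fun ω => ?_
    have hlow : ∀ k, ρ ω ≤ g k (d k ω) := fun k => by
      refine le_min (hρt ω) ?_
      rw [le_div_iff₀ (by positivity)]
      exact (Nat.lt_floor_add_one _).le
    have hup : ∀ k, g k (d k ω) ≤ ρ ω + 1 / ((k : ℝ≥0) + 1) := fun k => by
      refine (min_le_right _ _).trans ?_
      have hk : (0 : ℝ≥0) < (k : ℝ≥0) + 1 := by positivity
      rw [add_div]
      gcongr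
      rw [div_le_iff₀ hk]
      exact Nat.floor_le zero_le
    have hlim : Tendsto (fun k : ℕ => ρ ω + 1 / ((k : ℝ≥0) + 1)) atTop (nhds (ρ ω)) := by
      simpa using (tendsto_const_nhds (x := ρ ω)).add
        (tendsto_one_div_add_atTop_nhds_zero_nat (𝕜 := ℝ≥0))
    have hg : Tendsto (fun k => g k (d k ω)) atTop (nhds (ρ ω)) :=
      tendsto_of_tendsto_of_tendsto_of_le_of_le tendsto_const_nhds hlim hlow hup
    exact (hrc ω (ρ ω)).tendsto.comp
      (tendsto_nhdsWithin_iff.2 ⟨hg, Eventually.of_forall hlow⟩)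

/-- For a right-continuous adapted process, the event that the level `c` has been exceeded strictly
before time `s` belongs to the `σ`-algebra at any time `t ≥ s`. -/
theorem measurableSet_exists_lt_of_rightContinuous {Ω : Type*} {m : MeasurableSpace Ω}
    {X : ℝ≥0 → Ω → ℝ} {s : ℝ≥0} (hX : ∀ u < s, Measurable (X u))
    (hrc : ∀ ω u, ContinuousWithinAt (fun v => X v ω) (Ici u) u) (c : ℝ) :
    MeasurableSet {ω | ∃ u < s, c < X u ω} := by
  obtain ⟨D, hDc, hD⟩ := TopologicalSpace.exists_countable_dense ℝ≥0
  have heq : {ω | ∃ u < s, c < X u ω} = ⋃ q ∈ D ∩ Iio s, {ω | c < X q ω} := by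
    ext ω
    simp only [mem_ofPred_eq, mem_iUnion, exists_prop, mem_inter_iff, mem_Iio]
    constructor
    · rintro ⟨u, hus, hu⟩
      have hev : {v | c < X v ω} ∈ nhdsWithin u (Ioi u) :=
        nhdsWithin_mono u Ioi_subset_Ici_self ((hrc ω u).eventually (lt_mem_nhds hu))
      obtain ⟨w, hw, hsub⟩ := (mem_nhdsGT_iff_exists_Ioo_subset' hus).1 hev
      obtain ⟨q, hqD, hq⟩ := hD.exists_between (lt_min hw hus)
      exact ⟨q, ⟨hqD, hq.2.trans_le (min_le_right _ _)⟩,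
        hsub ⟨hq.1, hq.2.trans_le (min_le_left _ _)⟩⟩
    · rintro ⟨q, ⟨-, hqs⟩, hq⟩
      exact ⟨q, hqs, hq⟩
  rw [heq]
  exact MeasurableSet.biUnion (hDc.mono inter_subset_left) fun q hq =>
    measurableSet_lt measurable_const (hX q hq.2)

/-- A right-continuous process stopped when it first exceeds the level `c` is, at time `t`,
measurable with respect to any `σ`-algebra making the process measurable up to time `t`. -/
theorem measurable_stopped_at_level {Ω : Type*} {m : MeasurableSpace Ω}
    {X : ℝ≥0 → Ω → ℝ} {t : ℝ≥0} (hX : ∀ u ≤ t, Measurable (X u))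
    (hrc : ∀ ω u, ContinuousWithinAt (fun v => X v ω) (Ici u) u) (c : ℝ) :
    Measurable fun ω => if ∃ u : ℝ≥0, c < X u ω then
      X (min t (sInf {u : ℝ≥0 | c < X u ω})) ω else X t ω := by
  let ρ : Ω → ℝ≥0 := fun ω =>
    if ∃ u : ℝ≥0, c < X u ω then min t (sInf {u : ℝ≥0 | c < X u ω}) else t
  have hρt : ∀ ω, ρ ω ≤ t := fun ω => by
    dsimp only [ρ]
    split_ifs
    exacts [min_le_left _ _, le_rfl]
  have hρ : Measurable ρ := by
    refine measurable_of_Iio fun s => ?_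
    rcases lt_or_ge t s with hts | hst
    · convert MeasurableSet.univ
      exact eq_univ_of_forall fun ω => (hρt ω).trans_lt hts
    · convert measurableSet_exists_lt_of_rightContinuous (s := s)
        (fun u hu => hX u (hu.le.trans hst)) hrc c using 1
      ext ω
      simp only [mem_preimage, mem_Iio, mem_ofPred_eq, ρ]
      split_ifs with h
      · rw [min_lt_iff, or_iff_right hst.not_gt, csInf_lt_iff (s := {u | c < X u ω}) (OrderBot.bddBelow _) h]
        simp only [mem_ofPred_eq, and_comm]
      · exact iff_of_false hst.not_gt fun ⟨u, _, hu⟩ => h ⟨u, hu⟩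
  convert measurable_sample_of_rightContinuous hX hrc hρ hρt using 2 with ω
  dsimp only [ρ]
  split_ifs <;> rfl

/-- If `Z n` are a.e. non-negative integrable functions, and on each event `{Y = n}` the integral
of `Z n` is that of a fixed integrable `f`, then the selection `ω ↦ Z (Y ω) ω` is integrable. -/
theorem integrable_select_of_setIntegral_eq {Ω : Type*} {m0 : MeasurableSpace Ω} {μ : Measure Ω}
    {Z : ℕ → Ω → ℝ} {f : Ω → ℝ} {Y : Ω → ℕ} (hY : Measurable Y)
    (hZ : ∀ n, Integrable (Z n) μ) (hZ0 : ∀ n, 0 ≤ᵐ[μ] Z n) (hf : Integrable f μ)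
    (hZf : ∀ n, ∫ ω in Y ⁻¹' {n}, Z n ω ∂μ = ∫ ω in Y ⁻¹' {n}, f ω ∂μ) :
    Integrable (fun ω => Z (Y ω) ω) μ := by
  have hs : ∀ n, MeasurableSet (Y ⁻¹' {n}) := fun n => hY (measurableSet_singleton n)
  have hU : ⋃ n, Y ⁻¹' {n} = univ := by ext; simp
  have hdisj : Pairwise (Function.onFun Disjoint fun n => Y ⁻¹' {n}) :=
    fun i j hij => Disjoint.preimage _ (by simpa using hij)
  have hon : ∀ n, EqOn (Z n) (fun ω => Z (Y ω) ω) (Y ⁻¹' {n}) := by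
    rintro n ω rfl
    rfl
  rw [← integrableOn_univ, ← hU]
  refine integrableOn_iUnion_of_summable_integral_norm
    (fun n => (hZ n).integrableOn.congr_fun (hon n) (hs n)) ?_
  refine (hasSum_integral_iUnion hs hdisj hf.integrableOn).summable.congr fun n => ?_
  rw [← hZf n]
  refine setIntegral_congr_ae (hs n) ?_
  filter_upwards [hZ0 n] with ω h0 hω
  obtain rfl : Y ω = n := hω
  exact (Real.norm_of_nonneg h0).symm

/-- Conditional expectation commutes with selection along a countable measurable partition. -/
theorem condExp_select_ae_eq {Ω : Type*} {m m0 : MeasurableSpace Ω} {μ : Measure Ω}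
    {Z : ℕ → Ω → ℝ} {Y : Ω → ℕ} (hY : Measurable[m] Y)
    (hZ : ∀ n, Integrable (Z n) μ) (hL : Integrable (fun ω => Z (Y ω) ω) μ) :
    μ[fun ω => Z (Y ω) ω | m] =ᵐ[μ] fun ω => (μ[Z (Y ω) | m]) ω := by
  have hs : ∀ n, MeasurableSet[m] (Y ⁻¹' {n}) := fun n => hY (measurableSet_singleton n)
  have hind : ∀ n, (Y ⁻¹' {n}).indicator (fun ω => Z (Y ω) ω) = (Y ⁻¹' {n}).indicator (Z n) := by
    refine fun n => indicator_congr ?_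
    rintro ω rfl
    rfl
  have hL' := ae_all_iff.2 fun n => condExp_indicator hL (hs n)
  have hZ' := ae_all_iff.2 fun n => condExp_indicator (hZ n) (hs n)
  filter_upwards [hL', hZ'] with ω h₁ h₂
  have h := (h₁ (Y ω)).symm.trans ((congrArg (fun f => (μ[f | m]) ω) (hind (Y ω))).trans (h₂ (Y ω)))
  simpa using h

/-- **Stopping at an independent level produces a uniformly integrable martingale.**
Let `(M_t)_{t≥0}` be a non-negative right-continuous supermartingale such that for
every `n` the process stopped at `τ_n = inf{t ≥ 0 : M_t > n}` is a uniformly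
integrable martingale closed by its a.s. limit, with terminal expectation `E[M_0]`.
Let `Y` be an `ℕ`-valued `G_0`-measurable random variable independent of the
σ-algebra generated by `M`, and let `σ = inf{t ≥ 0 : M_t > Y}` (with the convention
that on `{σ = ∞}` the stopped process is `M` itself).  Then the stopped process
`M^σ` is a uniformly integrable martingale; in particular its a.s. limit `M^σ_∞`
exists and `E[M^σ_∞] = E[M_0]`. -/
theorem stopped_process_uniformly_integrable_martingale
    {Ω : Type*} {m0 : MeasurableSpace Ω} (μ : Measure Ω) [IsProbabilityMeasure μ]
    (𝒢 : Filtration ℝ≥0 m0) (M : ℝ≥0 → Ω → ℝ)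
    (hsuper : Supermartingale M 𝒢 μ)
    (hnonneg : ∀ t ω, 0 ≤ M t ω)
    (hrc : ∀ ω t, ContinuousWithinAt (fun u => M u ω) (Ici t) t)
    (Mτ : ℕ → ℝ≥0 → Ω → ℝ)
    (hMτ : ∀ n t ω, Mτ n t ω =
      if ∃ u : ℝ≥0, (n : ℝ) < M u ω then
        M (min t (sInf {u : ℝ≥0 | (n : ℝ) < M u ω})) ω
      else M t ω)
    (hUI : ∀ n : ℕ, ∃ Mlim : Ω → ℝ, Integrable Mlim μ ∧
      (∀ᵐ ω ∂μ, Tendsto (fun t => Mτ n t ω) atTop (nhds (Mlim ω))) ∧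
      (∀ t, Mτ n t =ᵐ[μ] μ[Mlim | 𝒢 t]) ∧
      ∫ ω, Mlim ω ∂μ = ∫ ω, M 0 ω ∂μ)
    (Y : Ω → ℕ) (hY0 : Measurable[𝒢 0] Y)
    (hYindep : ProbabilityTheory.Indep
      (MeasurableSpace.comap Y inferInstance)
      (⨆ t : ℝ≥0, MeasurableSpace.comap (M t) inferInstance) μ)
    (Mσ : ℝ≥0 → Ω → ℝ)
    (hMσ : ∀ t ω, Mσ t ω =
      if ∃ u : ℝ≥0, (Y ω : ℝ) < M u ω then
        M (min t (sInf {u : ℝ≥0 | (Y ω : ℝ) < M u ω})) ω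
      else M t ω) :
    Martingale Mσ 𝒢 μ ∧ UniformIntegrable Mσ 1 μ ∧
      ∃ Mσlim : Ω → ℝ,
        (∀ᵐ ω ∂μ, Tendsto (fun t => Mσ t ω) atTop (nhds (Mσlim ω))) ∧
        ∫ ω, Mσlim ω ∂μ = ∫ ω, M 0 ω ∂μ := by
  choose Z hZint hZlim hZcond _ using hUI
  have hselect : ∀ t ω, Mσ t ω = Mτ (Y ω) t ω := fun t ω => by rw [hMσ, hMτ]
  have hMτ0 : ∀ n, Mτ n 0 = M 0 := fun n => by
    ext ω
    simp [hMτ]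
  have hMτ_nonneg : ∀ n t ω, 0 ≤ Mτ n t ω := fun n t ω => by
    rw [hMτ]
    split_ifs <;> exact hnonneg _ _
  have hZ0 : ∀ n, 0 ≤ᵐ[μ] Z n := fun n => by
    filter_upwards [hZlim n] with ω hω
    exact ge_of_tendsto' hω fun t => hMτ_nonneg n t ω
  have hYt : ∀ t, Measurable[𝒢 t] Y := fun t => hY0.mono (𝒢.mono zero_le) le_rfl
  have hset : ∀ n, ∫ ω in Y ⁻¹' {n}, Z n ω ∂μ = ∫ ω in Y ⁻¹' {n}, M 0 ω ∂μ := fun n => by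
    rw [← setIntegral_condExp (𝒢.le 0) (hZint n) (hY0 (measurableSet_singleton n)), ← hMτ0 n]
    exact integral_congr_ae (ae_restrict_of_ae (hZcond n 0).symm)
  have hL : Integrable (fun ω => Z (Y ω) ω) μ :=
    integrable_select_of_setIntegral_eq (hY0.mono (𝒢.le 0) le_rfl) hZint hZ0
      (hsuper.integrable 0) hset
  have hcond : ∀ t, μ[fun ω => Z (Y ω) ω | 𝒢 t] =ᵐ[μ] Mσ t := fun t => by
    filter_upwards [condExp_select_ae_eq (hYt t) hZint hL, ae_all_iff.2 fun n => hZcond n t]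
      with ω h₁ h₂
    rw [h₁, hselect, h₂]
  have hadapted : StronglyAdapted 𝒢 Mσ := fun t => by
    have hF : Measurable[Prod.instMeasurableSpace (m₂ := 𝒢 t)] fun p : ℕ × Ω => Mτ p.1 t p.2 := by
      refine @measurable_from_prod_countable_right _ _ _ _ (𝒢 t) _ _ _ _ fun n => ?_
      simp only [hMτ]
      exact measurable_stopped_at_level (m := 𝒢 t)
        (fun u hu => ((hsuper.stronglyMeasurable u).mono (𝒢.mono hu)).measurable) hrc n
    have hM : Measurable[𝒢 t] (Mσ t) := by
      rw [funext (hselect t)]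
      exact hF.comp ((hYt t).prodMk measurable_id)
    exact hM.stronglyMeasurable
  refine ⟨⟨hadapted, fun s t hst => ?_⟩, hL.uniformIntegrable_condExp_filtration.ae_eq hcond,
    fun ω => Z (Y ω) ω, ?_, ?_⟩
  · exact (condExp_congr_ae (hcond t).symm).trans
      ((𝒢.condExp_condExp _ hst).trans (hcond s))
  · filter_upwards [ae_all_iff.2 hZlim] with ω hω
    simpa only [hselect] using hω (Y ω)
  · rw [← integral_condExp (𝒢.le 0), integral_congr_ae (hcond 0)]
    exact integral_congr_ae (Eventually.of_forall fun ω => by rw [hselect, hMτ0])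
end
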